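/- arXiv:1611.10304 — 2 statements merged into one kernel-verified Lean document; each statement's English description precedes it below -/
import Mathlib

section
/- For r ∈ [0,1], let π_r be a non-zero finite measure on [r,∞) which may have an atom at r and has a non-increasing density on (r,∞) with respect to Lebesgue measure, and suppose r ↦ π_r is vaguely continuous. Then there exists a finite measure μ on [0,1] such that the measure π̄(E) = ∫_{[0,1]} π_r(E) μ(dr) has a density with respect to Lebesgue measure which equals 1 on [0,1] and is non-increasing on [1,∞). -/
open MeasureTheory
open scoped ENNReal
open Set Filter Topology
open scoped NNReal BoundedContinuousFunction

/-- A lower triangular system with rows non-increasing past the diagonal has a non-negative solution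
with constant right-hand side `c`, and the later columns are then bounded by `c`. -/
theorem exists_triangular_weights (p : ℕ → ℕ → ℝ≥0∞) (c : ℝ≥0∞) (n : ℕ)
    (hanti : ∀ i < n, ∀ j, i ≤ j → p i (j + 1) ≤ p i j)
    (hzero : ∀ i < n, ∀ j < i, p i j = 0)
    (hpos : ∀ i < n, p i i ≠ 0) (hfin : ∀ i < n, p i i ≠ ∞) :
    ∃ w : ℕ → ℝ≥0∞, (∀ j < n, ∑ i ∈ Finset.range n, w i * p i j = c) ∧
      ∀ j, ∑ i ∈ Finset.range n, w i * p i j ≤ c := by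
  induction n with
  | zero => exact ⟨0, by simp, by simp⟩
  | succ n ih =>
    obtain ⟨w, hw, hle⟩ := ih (fun i hi => hanti i (by omega)) (fun i hi => hzero i (by omega))
      (fun i hi => hpos i (by omega)) (fun i hi => hfin i (by omega))
    set v : ℕ → ℝ≥0∞ :=
      Function.update w n ((c - ∑ i ∈ Finset.range n, w i * p i n) / p n n) with hv
    have hsum : ∀ j, ∑ i ∈ Finset.range (n + 1), v i * p i j =
        ∑ i ∈ Finset.range n, w i * p i j + v n * p n j := by
      intro j
      rw [Finset.sum_range_succ]
      congr 1
      refine Finset.sum_congr rfl fun i hi => ?_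
      rw [hv, Function.update_of_ne (Finset.mem_range.1 hi).ne]
    have heq : ∀ j < n + 1, ∑ i ∈ Finset.range (n + 1), v i * p i j = c := by
      intro j hj
      rw [hsum]
      rcases Nat.lt_succ_iff_lt_or_eq.1 hj with h | rfl
      · rw [hzero n (by omega) j h, mul_zero, add_zero, hw j h]
      · rw [hv, Function.update_self,
          ENNReal.div_mul_cancel (hpos j (by omega)) (hfin j (by omega)),
          add_tsub_cancel_of_le (hle j)]
    have hge : ∀ j, n ≤ j → ∑ i ∈ Finset.range (n + 1), v i * p i j ≤ c := by
      intro j hj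
      induction j, hj using Nat.le_induction with
      | base => exact (heq n (by omega)).le
      | succ j hj ihj =>
        refine le_trans (Finset.sum_le_sum fun i hi => ?_) ihj
        have hi' := Finset.mem_range.1 hi
        gcongr
        exact hanti i hi' j (by omega)
    refine ⟨v, heq, fun j => ?_⟩
    rcases lt_or_ge j n with h | h
    · exact (heq j (by omega)).le
    · exact hge j h

theorem le_volume_of_forall_Ioc {ν : Measure ℝ}
    (h : ∀ a b, ν (Ioc a b) ≤ ENNReal.ofReal (b - a)) : ν ≤ volume := by
  rw [← Measure.toOuterMeasure_le, Real.volume_eq_stieltjes_id]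
  have key : ν.toOuterMeasure ≤ StieltjesFunction.id.outer := by
    refine OuterMeasure.le_ofFunction.2 fun s => ?_
    rw [StieltjesFunction.length_eq]
    refine le_iInf fun a => le_iInf fun b => le_iInf fun hs => ?_
    have : s ⊆ Ioc a b := fun x hx =>
      hs ⟨hx, notMem_botSet_of_lt (sub_one_lt x)⟩
    exact (measure_mono this).trans (h a b)
  rwa [StieltjesFunction.measure]

/-- The non-increasing version of the density is obtained by differentiating along right
neighbourhoods. -/
theorem exists_density_of_le_volume {ν : Measure ℝ} (hν : ν ≤ volume) (hneg : ν (Iio 0) = 0)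
    (hone : 1 ≤ ν (Icc 0 1))
    (hshift : ∀ a b h, 1 ≤ a → 0 ≤ h → ν (Ico (a + h) (b + h)) ≤ ν (Ico a b)) :
    ∃ g : ℝ → ℝ≥0∞, (∀ t ∈ Icc (0 : ℝ) 1, g t = 1) ∧ (∀ s t : ℝ, 1 ≤ s → s ≤ t → g t ≤ g s) ∧
      ∀ E : Set ℝ, MeasurableSet E → ν E = ∫⁻ t in E, g t := by
  have hac : ν ≪ volume := Measure.absolutelyContinuous_of_le hν
  have : NullSingletonClass ν := ⟨fun x => hac (by simp)⟩
  have : IsLocallyFiniteMeasure ν := ⟨fun x => by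
    obtain ⟨s, hs, hlt⟩ := (volume : Measure ℝ).finiteAt_nhds x
    exact ⟨s, hs, (hν s).trans_lt hlt⟩⟩
  set q : ℝ → ℕ → ℝ≥0∞ := fun t k =>
    ν (Icc t (t + 1 / ((k : ℝ) + 1))) / volume (Icc t (t + 1 / ((k : ℝ) + 1))) with hq
  set d : ℝ → ℝ≥0∞ := fun t => liminf (q t) atTop with hd
  have hd_eq : ∀ᵐ t, d t = ν.rnDeriv volume t := by
    filter_upwards [VitaliFamily.ae_tendsto_rnDeriv
      (IsUnifLocDoublingMeasure.vitaliFamily (volume : Measure ℝ) 1) ν] with t ht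
    have hlim : Tendsto (fun k : ℕ => t + 1 / ((k : ℝ) + 1)) atTop (𝓝[>] t) := by
      refine tendsto_nhdsWithin_iff.2 ⟨?_, Eventually.of_forall fun k => ?_⟩
      · simpa using tendsto_const_nhds.add (tendsto_one_div_add_atTop_nhds_zero_nat (𝕜 := ℝ))
      · simp only [mem_Ioi, lt_add_iff_pos_right]
        positivity
    exact ((ht.comp (Real.tendsto_Icc_vitaliFamily_right t)).comp hlim).liminf_eq
  have hd_le : ∀ t, d t ≤ 1 := by
    intro t
    refine liminf_le_of_le (by isBoundedDefault) fun b hb => ?_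
    obtain ⟨k, hk⟩ := hb.exists
    exact hk.trans (ENNReal.div_le_of_le_mul (by simpa only [one_mul] using hν _))
  have hd_anti : ∀ s t, 1 ≤ s → s ≤ t → d t ≤ d s := by
    intro s t hs hst
    refine liminf_le_liminf (Eventually.of_forall fun k => ?_)
    have h1 := hshift s (s + 1 / ((k : ℝ) + 1)) (t - s) hs (by linarith)
    rw [add_sub_cancel, show s + 1 / ((k : ℝ) + 1) + (t - s) = t + 1 / ((k : ℝ) + 1) by ring,
      measure_congr Ico_ae_eq_Icc, measure_congr Ico_ae_eq_Icc] at h1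
    simp only [hq, Real.volume_Icc, add_sub_cancel_left]
    gcongr
  have hνd : ∀ E, MeasurableSet E → ν E = ∫⁻ t in E, d t := by
    intro E hE
    rw [← Measure.setLIntegral_rnDeriv hac E]
    exact lintegral_congr_ae (ae_restrict_of_ae (hd_eq.mono fun t ht => ht.symm))
  have hunit : ν.restrict (Icc 0 1) = volume.restrict (Icc (0 : ℝ) 1) := by
    have hle : ν.restrict (Icc 0 1) ≤ volume.restrict (Icc (0 : ℝ) 1) :=
      Measure.restrict_mono subset_rfl hν
    have : IsFiniteMeasure (ν.restrict (Icc 0 1)) := isFiniteMeasure_of_le _ hle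
    refine Measure.eq_of_le_of_measure_univ_eq hle (le_antisymm (hle _) ?_)
    simpa using hone
  set g : ℝ → ℝ≥0∞ := (Icc 0 1).indicator 1 + (Ioi 1).indicator d with hg
  have hg_one : ∀ t ∈ Icc (0 : ℝ) 1, g t = 1 := by
    intro t ht
    simp [hg, ht.1, ht.2]
  have hg_gt : ∀ t, 1 < t → g t = d t := by
    intro t ht
    simp [hg, ht]
  refine ⟨g, hg_one, fun s t hs hst => ?_, fun E hE => ?_⟩
  · rcases hs.eq_or_lt with rfl | hs'
    · rw [hg_one 1 (by simp)]
      rcases hst.eq_or_lt with rfl | ht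
      · exact (hg_one 1 (by simp)).le
      · rw [hg_gt t ht]; exact hd_le t
    · rw [hg_gt s hs', hg_gt t (by linarith)]
      exact hd_anti s t hs hst
  · have h1 : ν (E ∩ Icc 0 1) = volume (E ∩ Icc 0 1) := by
      rw [← Measure.restrict_apply hE, hunit, Measure.restrict_apply hE]
    have hν_split : ν E = ν (E ∩ Icc 0 1) + ν (E ∩ Ioi 1) := by
      rw [← measure_inter_add_sdiff E (measurableSet_Ioi (a := (1 : ℝ))), add_comm]
      congr 1
      refine (measure_eq_measure_of_null_sdiff (s := E ∩ Icc 0 1) (t := E \ Ioi 1)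
        (fun x hx => ⟨hx.1, not_lt.2 hx.2.2⟩)
        (measure_mono_null (fun x hx => ?_) hneg)).symm
      by_contra h
      exact hx.2 ⟨hx.1.1, not_lt.1 h, not_lt.1 hx.1.2⟩
    have hgm : ∫⁻ t in E, g t =
        (∫⁻ t in E, (Icc (0 : ℝ) 1).indicator 1 t) + ∫⁻ t in E, (Ioi 1).indicator d t := by
      rw [hg]
      exact lintegral_add_left (measurable_one.indicator measurableSet_Icc) _
    rw [hν_split, hgm, h1, hνd _ (hE.inter measurableSet_Ioi), setLIntegral_indicator measurableSet_Ioi,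
      setLIntegral_indicator measurableSet_Icc, inter_comm (Ioi _), inter_comm (Icc _ _)]
    simp

theorem measure_Ico_add_le {m : Measure ℝ} {r : ℝ} {g : ℝ → ℝ≥0∞}
    (hg : ∀ s t : ℝ, r < s → s ≤ t → g t ≤ g s)
    (hm : ∀ E : Set ℝ, MeasurableSet E → E ⊆ Ioi r → m E = ∫⁻ t in E, g t)
    {a b h : ℝ} (ha : r ≤ a) (hh : 0 ≤ h) : m (Ico (a + h) (b + h)) ≤ m (Ico a b) := by
  rcases hh.eq_or_lt with rfl | hh
  · simp
  have hsub : Ico (a + h) (b + h) ⊆ Ioi r := fun x hx => by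
    have := hx.1
    simp only [mem_Ioi]
    linarith
  calc m (Ico (a + h) (b + h)) = ∫⁻ t in Ioo (a + h) (b + h), g t := by
        rw [hm _ measurableSet_Ico hsub, setLIntegral_congr Ioo_ae_eq_Ico]
    _ = ∫⁻ t in Ioo a b, g (t + h) := by
        rw [← lintegral_indicator measurableSet_Ioo, ← lintegral_indicator measurableSet_Ioo,
          ← lintegral_add_right_eq_self _ h]
        refine lintegral_congr fun t => ?_
        simp [indicator]
    _ ≤ ∫⁻ t in Ioo a b, g t :=
        setLIntegral_mono' measurableSet_Ioo fun t ht => hg _ _ (ha.trans_lt ht.1) (by linarith)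
    _ = m (Ioo a b) := (hm _ measurableSet_Ioo fun t ht => ha.trans_lt ht.1).symm
    _ ≤ m (Ico a b) := measure_mono Ioo_subset_Ico_self

theorem measure_Ico_ne_zero {m : Measure ℝ} {r : ℝ} (hne : m ≠ 0) (hnull : m (Iio r) = 0)
    (hshift : ∀ a b h, r ≤ a → 0 ≤ h → m (Ico (a + h) (b + h)) ≤ m (Ico a b))
    {h : ℝ} (hh : 0 < h) : m (Ico r (r + h)) ≠ 0 := by
  intro h0
  refine hne (Measure.measure_univ_eq_zero.1 ?_)
  have hcover : (univ : Set ℝ) ⊆ Iio r ∪ ⋃ k : ℕ, Ico (r + k * h) (r + h + k * h) := by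
    intro x _
    rcases lt_or_ge x r with hx | hx
    · exact Or.inl hx
    · refine Or.inr (mem_iUnion.2 ⟨⌊(x - r) / h⌋₊, ?_, ?_⟩)
      · have := (le_div_iff₀ hh).1 (Nat.floor_le (div_nonneg (sub_nonneg.2 hx) hh.le))
        linarith
      · have := (div_lt_iff₀ hh).1 (Nat.lt_floor_add_one ((x - r) / h))
        linarith
  refine measure_mono_null hcover (measure_union_null hnull (measure_iUnion_null fun k => ?_))
  exact le_antisymm ((hshift r (r + h) (k * h) le_rfl (by positivity)).trans h0.le) zero_le

theorem measure_Icc_le_of_forall_Ico_grid {ν : Measure ℝ} {n : ℕ} (hn : 0 < n)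
    (hν : ∀ j : ℤ, ν (Ico ((j : ℝ) / n) ((j + 1 : ℝ) / n)) ≤ ENNReal.ofReal (1 / n))
    {a b : ℝ} (hab : a ≤ b) : ν (Icc a b) ≤ ENNReal.ofReal (b - a + 2 / n) := by
  have hn' : (0 : ℝ) < n := by exact_mod_cast hn
  have hcover : Icc a b ⊆
      ⋃ j ∈ Finset.Icc ⌊a * n⌋ ⌊b * n⌋, Ico ((j : ℝ) / n) ((j + 1 : ℝ) / n) := by
    intro x hx
    simp only [mem_iUnion, Finset.mem_Icc]
    refine ⟨⌊x * n⌋, ⟨Int.floor_mono ?_, Int.floor_mono ?_⟩, ?_, ?_⟩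
    · exact mul_le_mul_of_nonneg_right hx.1 hn'.le
    · exact mul_le_mul_of_nonneg_right hx.2 hn'.le
    · exact (div_le_iff₀ hn').2 (Int.floor_le _)
    · exact (lt_div_iff₀ hn').2 (Int.lt_floor_add_one _)
  have hfloor : ⌊a * n⌋ ≤ ⌊b * n⌋ := Int.floor_mono (mul_le_mul_of_nonneg_right hab hn'.le)
  have hcard : ((Finset.Icc ⌊a * n⌋ ⌊b * n⌋).card : ℝ) ≤ (b - a) * n + 2 := by
    have h1 : ((Finset.Icc ⌊a * n⌋ ⌊b * n⌋).card : ℤ) = ⌊b * n⌋ + 1 - ⌊a * n⌋ := by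
      rw [Int.card_Icc, Int.toNat_of_nonneg (by omega)]
    have h2 : ((Finset.Icc ⌊a * n⌋ ⌊b * n⌋).card : ℝ) = ⌊b * n⌋ + 1 - ⌊a * n⌋ := by
      exact_mod_cast h1
    have h3 := Int.floor_le (b * n)
    have h4 := Int.lt_floor_add_one (a * n)
    rw [h2]
    linarith
  calc ν (Icc a b) ≤ ∑ j ∈ Finset.Icc ⌊a * n⌋ ⌊b * n⌋, ν (Ico ((j : ℝ) / n) ((j + 1 : ℝ) / n)) :=
        (measure_mono hcover).trans (measure_biUnion_finset_le _ _)
    _ ≤ ∑ _j ∈ Finset.Icc ⌊a * n⌋ ⌊b * n⌋, ENNReal.ofReal (1 / n) :=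
        Finset.sum_le_sum fun j _ => hν j
    _ = ENNReal.ofReal ((Finset.Icc ⌊a * n⌋ ⌊b * n⌋).card * (1 / n)) := by
        rw [Finset.sum_const, nsmul_eq_mul, ENNReal.ofReal_mul (by positivity),
          ENNReal.ofReal_natCast]
    _ ≤ ENNReal.ofReal (b - a + 2 / n) := by
        refine ENNReal.ofReal_le_ofReal ?_
        calc _ ≤ ((b - a) * n + 2) * (1 / n) := by gcongr
          _ = b - a + 2 / n := by field_simp

theorem one_le_measure_Icc_of_forall_Ico_grid {ν : Measure ℝ} {n : ℕ} (hn : 0 < n)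
    (hν : ∀ j < n, ν (Ico ((j : ℝ) / n) ((j + 1 : ℝ) / n)) = ENNReal.ofReal (1 / n)) :
    1 ≤ ν (Icc 0 1) := by
  have hn' : (0 : ℝ) < n := by exact_mod_cast hn
  have hmono : Monotone fun j : ℕ => (j : ℝ) / n := fun i j hij => by
    simp only
    gcongr
  have hdisj := hmono.pairwise_disjoint_on_Ico_succ
  have hsub : ⋃ j ∈ Finset.range n, Ico ((j : ℝ) / n) ((j + 1 : ℝ) / n) ⊆ Icc 0 1 := by
    refine iUnion₂_subset fun j hj x hx => ⟨le_trans (by positivity) hx.1, hx.2.le.trans ?_⟩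
    rw [div_le_one hn']
    exact_mod_cast Finset.mem_range.1 hj
  refine le_trans (le_of_eq ?_) (measure_mono hsub)
  rw [measure_biUnion_finset (fun i _ j _ hij => ?_) fun _ _ => measurableSet_Ico,
    Finset.sum_congr rfl fun j hj => hν j (Finset.mem_range.1 hj), Finset.sum_const, nsmul_eq_mul,
    Finset.card_range, ← ENNReal.ofReal_natCast, ← ENNReal.ofReal_mul (by positivity),
    mul_one_div_cancel hn'.ne', ENNReal.ofReal_one]
  simpa [Function.onFun] using hdisj hij

/-- A family of finite measures indexed by `[0,1]`, the one at `x` carried by `[x,∞)` and not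
increasing there under translation to the right, depending vaguely continuously on `x`. -/
structure IsDecreasingFamily (K : Icc (0 : ℝ) 1 → Measure ℝ) : Prop where
  ne_zero : ∀ x, K x ≠ 0
  isFiniteMeasure : ∀ x, IsFiniteMeasure (K x)
  measure_Iio : ∀ x, K x (Iio x) = 0
  measure_Ico_add_le : ∀ (x : Icc (0 : ℝ) 1) (a b h : ℝ), x ≤ a → 0 ≤ h →
    K x (Ico (a + h) (b + h)) ≤ K x (Ico a b)
  continuous_lintegral : ∀ f : ℝ →ᵇ ℝ≥0, HasCompactSupport f → Continuous fun x => ∫⁻ t, f t ∂K x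

theorem hasCompactSupport_thickenedIndicator_Icc {δ : ℝ} (hδ : 0 < δ) (a b : ℝ) :
    HasCompactSupport (thickenedIndicator hδ (Icc a b)) :=
  HasCompactSupport.intro (isCompact_Icc.cthickening (r := δ)) fun _ hx =>
    thickenedIndicator_zero hδ _ fun h => hx (Metric.thickening_subset_cthickening _ _ h)

theorem lintegral_thickenedIndicator_le_measure (m : Measure ℝ) {δ : ℝ} (hδ : 0 < δ) (a b : ℝ) :
    ∫⁻ t, thickenedIndicator hδ (Icc a b) t ∂m ≤ m (Icc (a - δ) (b + δ)) := by
  rw [← lintegral_indicator_one measurableSet_Icc]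
  refine lintegral_mono fun t => ?_
  by_cases ht : t ∈ Icc (a - δ) (b + δ)
  · rw [indicator_of_mem ht]
    exact ENNReal.coe_le_one_iff.2 (thickenedIndicator_le_one hδ _ t)
  · rw [thickenedIndicator_zero hδ _ fun h => ht ?_]
    · simp
    · obtain ⟨y, hy, hty⟩ := Metric.mem_thickening_iff.1 h
      rw [Real.dist_eq, abs_lt] at hty
      exact ⟨by linarith [hy.1], by linarith [hy.2]⟩

namespace IsDecreasingFamily

variable {K : Icc (0 : ℝ) 1 → Measure ℝ}

theorem measurable (hK : IsDecreasingFamily K) : Measurable K := by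
  have := hK.isFiniteMeasure
  have hIcc : ∀ a b, Measurable fun x => K x (Icc a b) := by
    intro a b
    refine measurable_of_tendsto_metrizable
      (f := fun (k : ℕ) x => ∫⁻ t, thickenedIndicator (Nat.one_div_pos_of_nat (n := k) (α := ℝ))
        (Icc a b) t ∂K x) (fun k => ?_) (tendsto_pi_nhds.2 fun x => ?_)
    · exact (hK.continuous_lintegral _ (hasCompactSupport_thickenedIndicator_Icc _ _ _)).measurable
    · exact tendsto_lintegral_thickenedIndicator_of_isClosed (K x) isClosed_Icc _
        tendsto_one_div_add_atTop_nhds_zero_nat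
  refine Measurable.measure_of_isPiSystem
    ((BorelSpace.measurable_eq (α := ℝ)).trans (borel_eq_generateFrom_Icc ℝ))
    (isPiSystem_Icc id id) ?_ ?_
  · rintro _ ⟨a, b, _, rfl⟩
    exact hIcc _ _
  · refine measurable_of_tendsto_metrizable (f := fun (k : ℕ) x => K x (Icc (-(k : ℝ)) k))
      (fun k => hIcc _ _) (tendsto_pi_nhds.2 fun x => ?_)
    have hmono : Monotone fun k : ℕ => Icc (-(k : ℝ)) k := fun i j hij =>
      Icc_subset_Icc (neg_le_neg (by exact_mod_cast hij)) (by exact_mod_cast hij)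
    have := tendsto_measure_iUnion_atTop (μ := K x) hmono
    rwa [eq_univ_of_forall fun y => mem_iUnion.2 ?_] at this
    obtain ⟨k, hk⟩ := exists_nat_ge |y|
    exact ⟨k, abs_le.1 hk⟩

/-- For each grid size there is a mixture giving every cell of the grid in `[0,1)` its length and
every other cell at most its length. -/
theorem exists_grid_mixture (hK : IsDecreasingFamily K) {n : ℕ} (hn : 0 < n) :
    ∃ m : Measure (Icc (0 : ℝ) 1),
      (∀ j < n, m.bind K (Ico ((j : ℝ) / n) ((j + 1 : ℝ) / n)) = ENNReal.ofReal (1 / n)) ∧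
      ∀ j : ℤ, m.bind K (Ico ((j : ℝ) / n) ((j + 1 : ℝ) / n)) ≤ ENNReal.ofReal (1 / n) := by
  have hn' : (0 : ℝ) < n := by exact_mod_cast hn
  have := hK.isFiniteMeasure
  set x : ℕ → Icc (0 : ℝ) 1 := fun i => projIcc 0 1 zero_le_one ((i : ℝ) / n) with hx
  have hx_coe : ∀ i < n, (x i : ℝ) = (i : ℝ) / n := by
    intro i hi
    have : (i : ℝ) ≤ n := by exact_mod_cast hi.le
    simp only [hx]
    rw [projIcc_of_mem zero_le_one ⟨by positivity, (div_le_one hn').2 this⟩]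
  set p : ℕ → ℕ → ℝ≥0∞ := fun i j => K (x i) (Ico ((j : ℝ) / n) ((j + 1 : ℝ) / n)) with hp
  have hanti : ∀ i < n, ∀ j, i ≤ j → p i (j + 1) ≤ p i j := by
    intro i hi j hij
    have := hK.measure_Ico_add_le (x i) (j / n) ((j + 1) / n) (1 / n)
      (by rw [hx_coe i hi]; gcongr) (by positivity)
    simp only [hp]
    push_cast
    rwa [← add_div, ← add_div] at this
  have hzero : ∀ i < n, ∀ j < i, p i j = 0 := by
    intro i hi j hji
    refine measure_mono_null (fun y hy => ?_) (hK.measure_Iio (x i))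
    refine hy.2.trans_le ?_
    rw [hx_coe i hi]
    gcongr
    exact_mod_cast hji
  have hpos : ∀ i < n, p i i ≠ 0 := by
    intro i hi
    have := measure_Ico_ne_zero (hK.ne_zero (x i)) (hK.measure_Iio _)
      (hK.measure_Ico_add_le (x i)) (h := 1 / n) (by positivity)
    rwa [hx_coe i hi, ← add_div] at this
  obtain ⟨w, hw, hle⟩ := exists_triangular_weights p (ENNReal.ofReal (1 / n)) n hanti hzero hpos
    fun i _ => measure_ne_top _ _
  set m : Measure (Icc (0 : ℝ) 1) := ∑ i ∈ Finset.range n, w i • Measure.dirac (x i) with hm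
  have hmE : ∀ E, MeasurableSet E → m.bind K E = ∑ i ∈ Finset.range n, w i * K (x i) E := by
    intro E hE
    rw [Measure.bind_apply hE hK.measurable.aemeasurable, hm, lintegral_finsetSum_measure]
    simp
  refine ⟨m, fun j hj => ?_, fun j => ?_⟩
  · rw [hmE _ measurableSet_Ico, hw j hj]
  · rw [hmE _ measurableSet_Ico]
    rcases le_or_gt 0 j with hj | hj
    · lift j to ℕ using hj
      simpa using hle j
    · refine le_of_eq_of_le (Finset.sum_eq_zero fun i hi => ?_) zero_le
      refine mul_eq_zero_of_right _ (measure_mono_null (fun y hy => ?_) (hK.measure_Iio (x i)))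
      refine hy.2.trans_le (le_trans ?_ (x i).2.1)
      refine div_nonpos_of_nonpos_of_nonneg ?_ hn'.le
      exact_mod_cast hj

theorem exists_mass_bound (hK : IsDecreasingFamily K) :
    ∃ C : ℝ≥0, ∀ (n : ℕ) (m : Measure (Icc (0 : ℝ) 1)), 0 < n →
      (∀ j : ℤ, m.bind K (Ico ((j : ℝ) / n) ((j + 1 : ℝ) / n)) ≤ ENNReal.ofReal (1 / n)) →
      m univ ≤ C := by
  have := hK.isFiniteMeasure
  set f := thickenedIndicator one_pos (Icc (0 : ℝ) 2) with hf
  obtain ⟨x₀, -, hx₀⟩ := isCompact_univ.exists_isMinOn univ_nonempty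
    (hK.continuous_lintegral f (hasCompactSupport_thickenedIndicator_Icc _ _ _)).continuousOn
  set c := ∫⁻ t, f t ∂K x₀ with hc
  have hc0 : c ≠ 0 := by
    intro h0
    refine measure_Ico_ne_zero (hK.ne_zero x₀) (hK.measure_Iio _)
      (hK.measure_Ico_add_le x₀) one_pos (measure_mono_null (fun y hy => ?_)
      (le_antisymm ((measure_le_lintegral_thickenedIndicator (K x₀) measurableSet_Icc one_pos).trans h0.le)
        zero_le))
    exact ⟨x₀.2.1.trans hy.1, by linarith [hy.2, x₀.2.2]⟩
  have hctop : c ≠ ∞ := (BoundedContinuousFunction.lintegral_lt_top_of_nnreal _ f).ne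
  refine ⟨(6 / c).toNNReal, fun n m hn hm => ?_⟩
  rw [ENNReal.coe_toNNReal (ENNReal.div_ne_top (by simp) hc0),
    ENNReal.le_div_iff_mul_le (Or.inl hc0) (Or.inl hctop)]
  calc m univ * c = ∫⁻ _, c ∂m := by rw [lintegral_const, mul_comm]
    _ ≤ ∫⁻ x, ∫⁻ t, f t ∂K x ∂m := lintegral_mono fun x => hx₀ (mem_univ x)
    _ = ∫⁻ t, f t ∂m.bind K := (Measure.lintegral_bind hK.measurable.aemeasurable
        (by fun_prop)).symm
    _ ≤ m.bind K (Icc (0 - 1) (2 + 1)) := lintegral_thickenedIndicator_le_measure _ _ _ _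
    _ ≤ ENNReal.ofReal (2 + 1 - (0 - 1) + 2 / n) :=
        measure_Icc_le_of_forall_Ico_grid hn hm (by norm_num)
    _ ≤ ENNReal.ofReal 6 := by
        refine ENNReal.ofReal_le_ofReal ?_
        have : (2 : ℝ) / n ≤ 2 := div_le_self (by norm_num) (by exact_mod_cast hn)
        linarith
    _ = 6 := by simp

theorem exists_mixture (hK : IsDecreasingFamily K) :
    ∃ μ : Measure (Icc (0 : ℝ) 1), IsFiniteMeasure μ ∧ μ.bind K ≤ volume ∧
      1 ≤ μ.bind K (Icc 0 1) := by
  have := hK.isFiniteMeasure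
  obtain ⟨C, hC⟩ := hK.exists_mass_bound
  choose m hm_eq hm_le using fun n : ℕ => hK.exists_grid_mixture n.succ_pos
  have hmass : ∀ n, m n univ ≤ C := fun n => hC _ _ n.succ_pos (hm_le n)
  have hfin : ∀ n, IsFiniteMeasure (m n) := fun n => ⟨(hmass n).trans_lt ENNReal.coe_lt_top⟩
  set M : ℕ → FiniteMeasure (Icc (0 : ℝ) 1) := fun n => ⟨m n, hfin n⟩ with hM
  obtain ⟨μ, -, hμ⟩ :=
    (isCompact_setOfPred_finiteMeasure_le_of_compactSpace (Icc (0 : ℝ) 1) C).exists_mapClusterPt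
      (f := atTop) (u := M) (by
        refine tendsto_principal.2 (Eventually.of_forall fun n => ?_)
        rw [mem_ofPred_eq, ← ENNReal.coe_le_coe, FiniteMeasure.ennreal_mass]
        exact hmass n)
  obtain ⟨U, hU, hlim⟩ := mapClusterPt_iff_ultrafilter.1 hμ
  rw [FiniteMeasure.tendsto_iff_forall_lintegral_tendsto] at hlim
  have hbind : ∀ f : ℝ →ᵇ ℝ≥0, HasCompactSupport f →
      Tendsto (fun n => ∫⁻ t, f t ∂(m n).bind K) U (𝓝 (∫⁻ t, f t ∂(μ : Measure _).bind K)) := by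
    intro f hf
    have hne : ∀ x, ∫⁻ t, f t ∂K x ≠ ∞ := fun x =>
      (BoundedContinuousFunction.lintegral_lt_top_of_nnreal _ f).ne
    have hcont : Continuous fun x => (∫⁻ t, f t ∂K x).toNNReal :=
      ENNReal.continuousOn_toNNReal.comp_continuous (hK.continuous_lintegral f hf) hne
    have h := hlim (BoundedContinuousFunction.mkOfCompact ⟨_, hcont⟩)
    simp only [BoundedContinuousFunction.mkOfCompact_apply, ContinuousMap.coe_mk,
      ENNReal.coe_toNNReal (hne _)] at h
    have hb : ∀ ρ : Measure (Icc (0 : ℝ) 1),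
        ∫⁻ t, f t ∂ρ.bind K = ∫⁻ x, ∫⁻ t, f t ∂K x ∂ρ := fun ρ =>
      Measure.lintegral_bind hK.measurable.aemeasurable (by fun_prop)
    simp only [hb]
    exact h
  have hsmall : Tendsto (fun n : ℕ => 2 / ((n.succ : ℕ) : ℝ)) U (𝓝 0) :=
    ((tendsto_const_div_atTop_nhds_zero_nat (2 : ℝ)).comp (tendsto_add_atTop_nat 1)).mono_left hU
  have hIcc : ∀ a b : ℝ, a ≤ b → (μ : Measure _).bind K (Icc a b) ≤ ENNReal.ofReal (b - a) := by
    intro a b hab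
    have hδ : ∀ δ : ℝ, 0 < δ →
        (μ : Measure _).bind K (Icc a b) ≤ ENNReal.ofReal (b - a + 2 * δ) := by
      intro δ hδ
      refine (measure_le_lintegral_thickenedIndicator _ measurableSet_Icc hδ).trans ?_
      have hr : Tendsto (fun n : ℕ => ENNReal.ofReal (b + δ - (a - δ) + 2 / ((n.succ : ℕ) : ℝ))) U
          (𝓝 (ENNReal.ofReal (b - a + 2 * δ))) := by
        refine ENNReal.tendsto_ofReal ?_
        convert tendsto_const_nhds.add hsmall using 2
        ring
      exact le_of_tendsto_of_tendsto'
        (hbind _ (hasCompactSupport_thickenedIndicator_Icc hδ a b)) hr fun n =>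
          (lintegral_thickenedIndicator_le_measure _ hδ a b).trans
            (measure_Icc_le_of_forall_Ico_grid n.succ_pos (hm_le n) (by linarith))
    have hr : Tendsto (fun δ : ℝ => ENNReal.ofReal (b - a + 2 * δ)) (𝓝[>] 0)
        (𝓝 (ENNReal.ofReal (b - a))) := by
      refine ENNReal.tendsto_ofReal (Tendsto.mono_left ?_ nhdsWithin_le_nhds)
      exact Continuous.tendsto' (by fun_prop) _ _ (by simp)
    exact ge_of_tendsto hr (eventually_mem_nhdsWithin.mono fun δ hδ' => hδ δ hδ')
  refine ⟨μ, inferInstance, le_volume_of_forall_Ioc fun a b => ?_, ?_⟩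
  · rcases le_or_gt a b with hab | hab
    · exact (measure_mono Ioc_subset_Icc_self).trans (hIcc a b hab)
    · simp [Ioc_eq_empty_of_le hab.le]
  · have hδ : ∀ δ : ℝ, 0 < δ →
        1 ≤ (μ : Measure _).bind K (Icc 0 1) + ENNReal.ofReal (2 * δ) := by
      intro δ hδ
      have h1 : 1 ≤ ∫⁻ t, thickenedIndicator hδ (Icc 0 1) t ∂(μ : Measure _).bind K :=
        ge_of_tendsto' (hbind _ (hasCompactSupport_thickenedIndicator_Icc hδ 0 1)) fun n =>
          (one_le_measure_Icc_of_forall_Ico_grid n.succ_pos (hm_eq n)).trans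
            (measure_le_lintegral_thickenedIndicator _ measurableSet_Icc hδ)
      refine h1.trans ((lintegral_thickenedIndicator_le_measure _ hδ 0 1).trans ?_)
      have hcover : Icc (0 - δ) (1 + δ) ⊆ Icc 0 1 ∪ (Icc (0 - δ) 0 ∪ Icc 1 (1 + δ)) := by
        intro y hy
        simp only [mem_union, mem_Icc] at hy ⊢
        grind
      refine (measure_mono hcover).trans ((measure_union_le _ _).trans ?_)
      gcongr
      refine (measure_union_le _ _).trans ((add_le_add (hIcc _ _ (by linarith))
        (hIcc _ _ (by linarith))).trans_eq ?_)
      rw [← ENNReal.ofReal_add (by linarith) (by linarith)]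
      congr 1
      ring
    have hr : Tendsto (fun δ : ℝ => (μ : Measure _).bind K (Icc 0 1) + ENNReal.ofReal (2 * δ))
        (𝓝[>] 0) (𝓝 ((μ : Measure _).bind K (Icc 0 1) + ENNReal.ofReal 0)) := by
      refine tendsto_const_nhds.add
        (ENNReal.tendsto_ofReal (Tendsto.mono_left ?_ nhdsWithin_le_nhds))
      exact Continuous.tendsto' (by fun_prop) _ _ (by simp)
    rw [ENNReal.ofReal_zero, add_zero] at hr
    exact ge_of_tendsto hr (eventually_mem_nhdsWithin.mono fun δ hδ' => hδ δ hδ')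

end IsDecreasingFamily

/-- For `r ∈ [0,1]`, let `π_r` be a non-zero finite measure on `[r,∞)`
(possible atom at `r`, non-increasing Lebesgue density on `(r,∞)`), depending vaguely
continuously on `r`. Then there is a finite measure `μ` on `[0,1]` such that
`π̄(E) = ∫ π_r(E) μ(dr)` has a Lebesgue density equal to `1` on `[0,1]` and
non-increasing on `[1,∞)`. -/
theorem statement12 (π : ℝ → Measure ℝ)
    (hne : ∀ r ∈ Set.Icc (0 : ℝ) 1, π r ≠ 0)
    (hfin : ∀ r ∈ Set.Icc (0 : ℝ) 1, IsFiniteMeasure (π r))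
    (hsupp : ∀ r ∈ Set.Icc (0 : ℝ) 1, π r (Set.Iio r) = 0)
    (hdens : ∀ r ∈ Set.Icc (0 : ℝ) 1, ∃ g : ℝ → ℝ≥0∞,
      (∀ s t : ℝ, r < s → s ≤ t → g t ≤ g s) ∧
      (∀ E : Set ℝ, MeasurableSet E → E ⊆ Set.Ioi r → π r E = ∫⁻ t in E, g t))
    (hcont : ∀ f : ℝ → ℝ, Continuous f → HasCompactSupport f →
      ContinuousOn (fun r => ∫ x, f x ∂(π r)) (Set.Icc (0 : ℝ) 1)) :
    ∃ μ : Measure ℝ, IsFiniteMeasure μ ∧ μ (Set.Icc (0 : ℝ) 1)ᶜ = 0 ∧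
      ∃ g : ℝ → ℝ≥0∞,
        (∀ t ∈ Set.Icc (0 : ℝ) 1, g t = 1) ∧
        (∀ s t : ℝ, 1 ≤ s → s ≤ t → g t ≤ g s) ∧
        ∀ E : Set ℝ, MeasurableSet E → (∫⁻ r, π r E ∂μ) = ∫⁻ t in E, g t := by
  have hK : IsDecreasingFamily fun x : Icc (0 : ℝ) 1 => π x := by
    refine ⟨fun x => hne x x.2, fun x => hfin x x.2, fun x => hsupp x x.2, ?_, fun f hf => ?_⟩
    · intro x a b h ha hh
      obtain ⟨g, hg, hπ⟩ := hdens x x.2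
      exact measure_Ico_add_le hg hπ ha hh
    · have hc := continuousOn_iff_continuous_domRestrict.1
        (hcont (fun t => f t) (by fun_prop) (hf.comp_left (g := ((↑) : ℝ≥0 → ℝ)) rfl))
      have heq : (fun x : Icc (0 : ℝ) 1 => ∫⁻ t, f t ∂π x) =
          fun x => ENNReal.ofReal ((Icc (0 : ℝ) 1).domRestrict (fun r => ∫ t, (f t : ℝ) ∂π r) x) := by
        funext x
        have := hfin x x.2
        rw [domRestrict_apply, ← BoundedContinuousFunction.toReal_lintegral_coe_eq_integral,
          ENNReal.ofReal_toReal (BoundedContinuousFunction.lintegral_lt_top_of_nnreal _ f).ne]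
      rw [heq]
      exact ENNReal.continuous_ofReal.comp hc
  obtain ⟨μ, hμ, hle, hone⟩ := hK.exists_mixture
  have happly : ∀ E, MeasurableSet E →
      μ.bind (fun x : Icc (0 : ℝ) 1 => π x) E = ∫⁻ x : Icc (0 : ℝ) 1, π x E ∂μ := fun E hE =>
    Measure.bind_apply hE hK.measurable.aemeasurable
  obtain ⟨g, hg_one, hg_anti, hg⟩ := exists_density_of_le_volume hle
    (by
      rw [happly _ measurableSet_Iio, lintegral_eq_zero_of_ae_eq_zero]
      exact Eventually.of_forall fun x =>
        measure_mono_null (Iio_subset_Iio x.2.1) (hK.measure_Iio x))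
    hone
    (fun a b h ha hh => by
      rw [happly _ measurableSet_Ico, happly _ measurableSet_Ico]
      exact lintegral_mono fun x => hK.measure_Ico_add_le x a b h (x.2.2.trans ha) hh)
  have hemb : MeasurableEmbedding ((↑) : Icc (0 : ℝ) 1 → ℝ) :=
    MeasurableEmbedding.subtype_coe measurableSet_Icc
  refine ⟨μ.map (↑), inferInstance, ?_, g, hg_one, hg_anti, fun E hE => ?_⟩
  · rw [hemb.map_apply]
    simp
  · rw [hemb.lintegral_map, ← happly E hE, hg E hE]
end

section
/- Let q ∈ [0,1). For r ∈ [q,1] let P_r be an isotropic unimodal probability measure on ℝᵈ∖B(0,r) (rotation invariant, possibly with singular part on the sphere of radius r, and with radially non-increasing Lebesgue density outside B(0,r)), depending vaguely continuously on r. Then there exist a probability measure μ on [q,1] and a constant c > 0 such that P̄(E) = ∫_{[q,1]} P_r(E) μ(dr) has a radial density P̄(z) with: P̄(z) = 0 on B(0,q), P̄(z) = c on B(0,1)∖B(0,q), and 0 ≤ P̄(z) ≤ c with non-increasing radial profile on ℝᵈ∖B(0,1). -/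
open MeasureTheory Metric
open scoped ENNReal

section Averaging

open Filter Set Topology

/-- A map into probability measures on a locally compact metric space which is continuous
for the vague topology is continuous for the weak topology. -/
theorem continuous_probabilityMeasure_of_vague {X E : Type*} [TopologicalSpace X]
    [FirstCountableTopology X] [MetricSpace E] [ProperSpace E] [MeasurableSpace E] [BorelSpace E]
    (Q : X → ProbabilityMeasure E)
    (h : ∀ f : E → ℝ, Continuous f → HasCompactSupport f →
      Continuous fun x => ∫ y, f y ∂(Q x : Measure E)) :
    Continuous Q := by
  refine continuous_iff_continuousAt.2 fun x₀ => ?_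
  refine tendsto_of_forall_isOpen_le_liminf' fun G hG => ?_
  rw [hG.measure_eq_iSup_isCompact]
  refine iSup₂_le fun K hKG => iSup_le fun hK => ?_
  obtain ⟨f, hfK, hfG, hfc, hf01⟩ :=
    exists_continuous_one_zero_of_isCompact hK hG.isClosed_compl
      (disjoint_compl_right_iff_subset.2 hKG)
  have hint : ∀ x, ENNReal.ofReal (∫ y, f y ∂(Q x : Measure E)) =
      ∫⁻ y, ENNReal.ofReal (f y) ∂(Q x : Measure E) := fun x =>
    ofReal_integral_eq_lintegral_ofReal (f.continuous.integrable_of_hasCompactSupport hfc)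
      (Eventually.of_forall fun y => (hf01 y).1)
  have hlim : Tendsto (fun x => ∫⁻ y, ENNReal.ofReal (f y) ∂(Q x : Measure E)) (𝓝 x₀)
      (𝓝 (∫⁻ y, ENNReal.ofReal (f y) ∂(Q x₀ : Measure E))) := by
    simp_rw [← hint]
    exact (ENNReal.continuous_ofReal.comp (h f f.continuous hfc)).continuousAt
  calc (Q x₀ : Measure E) K = ∫⁻ y, K.indicator 1 y ∂(Q x₀ : Measure E) := by
        rw [lintegral_indicator_one hK.measurableSet]
    _ ≤ ∫⁻ y, ENNReal.ofReal (f y) ∂(Q x₀ : Measure E) := by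
        refine lintegral_mono fun y => ?_
        by_cases hy : y ∈ K
        · simp [hy, hfK hy]
        · simp [hy]
    _ = liminf (fun x => ∫⁻ y, ENNReal.ofReal (f y) ∂(Q x : Measure E)) (𝓝 x₀) :=
        hlim.liminf_eq.symm
    _ ≤ liminf (fun x => (Q x : Measure E) G) (𝓝 x₀) := by
        refine liminf_le_liminf (Eventually.of_forall fun x => ?_)
        rw [← lintegral_indicator_one hG.measurableSet]
        refine lintegral_mono fun y => ?_
        by_cases hy : y ∈ G
        · simpa [hy] using (hf01 y).2
        · simp [hy, hfG hy]

/-- A weakly continuous family of probability measures is a measurable family of measures. -/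
theorem measurable_of_continuous_probabilityMeasure {X E : Type*} [TopologicalSpace X]
    [MeasurableSpace X] [OpensMeasurableSpace X] [TopologicalSpace E] [HasOuterApproxClosed E]
    [MeasurableSpace E] [BorelSpace E] {Q : X → ProbabilityMeasure E} (hQ : Continuous Q) :
    Measurable fun x => (Q x : Measure E) := by
  refine Measurable.measure_of_isPiSystem_of_isProbabilityMeasure
    (BorelSpace.measurable_eq (α := E)) isPiSystem_isOpen fun G hG => ?_
  refine LowerSemicontinuous.measurable (lowerSemicontinuous_iff_le_liminf.2 fun x => ?_)
  exact ProbabilityMeasure.le_liminf_measure_open_of_tendsto hQ.continuousAt hG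

/-- The mixture of a weakly continuous family of probability measures. -/
noncomputable def mixture {X E : Type*} [TopologicalSpace X] [MeasurableSpace X]
    [OpensMeasurableSpace X] [TopologicalSpace E] [HasOuterApproxClosed E] [MeasurableSpace E]
    [BorelSpace E] (m : ProbabilityMeasure X) (Q : X → ProbabilityMeasure E)
    (hQ : Continuous Q) : ProbabilityMeasure E :=
  ⟨(m : Measure X).bind fun x => (Q x : Measure E),
    ⟨by rw [Measure.bind_apply .univ
          (measurable_of_continuous_probabilityMeasure hQ).aemeasurable]; simp⟩⟩

section Mixture

variable {X E : Type*} [TopologicalSpace X] [MeasurableSpace X] [OpensMeasurableSpace X]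
  [TopologicalSpace E] [HasOuterApproxClosed E] [MeasurableSpace E] [BorelSpace E]
  {Q : X → ProbabilityMeasure E}

theorem mixture_apply (m : ProbabilityMeasure X) (hQ : Continuous Q) {A : Set E}
    (hA : MeasurableSet A) :
    (mixture m Q hQ : Measure E) A = ∫⁻ x, (Q x : Measure E) A ∂(m : Measure X) :=
  Measure.bind_apply hA (measurable_of_continuous_probabilityMeasure hQ).aemeasurable

theorem lintegral_mixture (m : ProbabilityMeasure X) (hQ : Continuous Q) {f : E → ℝ≥0∞}
    (hf : Measurable f) :
    ∫⁻ y, f y ∂(mixture m Q hQ : Measure E) = ∫⁻ x, ∫⁻ y, f y ∂(Q x : Measure E) ∂(m : Measure X) :=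
  Measure.lintegral_bind (measurable_of_continuous_probabilityMeasure hQ).aemeasurable
    hf.aemeasurable

theorem continuous_mixture [CompactSpace X] (hQ : Continuous Q) :
    Continuous fun m : ProbabilityMeasure X => mixture m Q hQ := by
  refine ProbabilityMeasure.continuous_iff_forall_continuous_lintegral.2 fun f => ?_
  have hfin : ∀ x, ∫⁻ y, f y ∂(Q x : Measure E) ≤ nndist f 0 := fun x => by
    refine (lintegral_mono fun y => ENNReal.coe_le_coe.2
      (BoundedContinuousFunction.NNReal.upper_bound f y)).trans ?_
    simp
  have hcont : Continuous fun x => ∫⁻ y, f y ∂(Q x : Measure E) :=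
    ProbabilityMeasure.continuous_iff_forall_continuous_lintegral.1 hQ f
  let F : BoundedContinuousFunction X NNReal := BoundedContinuousFunction.mkOfCompact
    ⟨fun x => (∫⁻ y, f y ∂(Q x : Measure E)).toNNReal, continuous_iff_continuousAt.2 fun x =>
      (ENNReal.tendsto_toNNReal ((hfin x).trans_lt ENNReal.coe_lt_top).ne).comp
        hcont.continuousAt⟩
  have hF : ∀ x, (F x : ℝ≥0∞) = ∫⁻ y, f y ∂(Q x : Measure E) := fun x =>
    ENNReal.coe_toNNReal ((hfin x).trans_lt ENNReal.coe_lt_top).ne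
  have := ProbabilityMeasure.continuous_lintegral_boundedContinuousFunction F
  simp_rw [hF] at this
  simpa only [lintegral_mixture _ hQ f.continuous.measurable.coe_nnreal_ennreal] using this

end Mixture

/-- Triangular averaging: if row `i` of `p` vanishes before the diagonal, is positive on it and
non-increasing after it, some convex combination of the first `n` rows is equal to a constant `c`
on the first `n` columns and at most `c` on the others. -/
theorem exists_weights_of_triangular (p : ℕ → ℕ → ℝ) (hzero : ∀ i j, j < i → p i j = 0)
    (hdiag : ∀ i, 0 < p i i) (hanti : ∀ i j, i ≤ j → p i (j + 1) ≤ p i j) (n : ℕ) (hn : 0 < n) :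
    ∃ w : ℕ → ℝ, (∀ i, 0 ≤ w i) ∧ ∑ i ∈ Finset.range n, w i = 1 ∧ ∃ c : ℝ, 0 < c ∧
      (∀ j < n, ∑ i ∈ Finset.range n, w i * p i j = c) ∧
      ∀ j, ∑ i ∈ Finset.range n, w i * p i j ≤ c := by
  have key : ∀ n, ∃ u : ℕ → ℝ, (∀ i, 0 ≤ u i) ∧ (∀ j < n, ∑ i ∈ Finset.range n, u i * p i j = 1) ∧
      ∀ j, ∑ i ∈ Finset.range n, u i * p i j ≤ 1 := by
    intro n
    induction n with
    | zero => exact ⟨0, by simp, by simp, by simp⟩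
    | succ n ih =>
      obtain ⟨u, hu0, hu1, hule⟩ := ih
      set a : ℝ := (1 - ∑ i ∈ Finset.range n, u i * p i n) / p n n with ha
      have ha0 : 0 ≤ a := div_nonneg (sub_nonneg.2 (hule n)) (hdiag n).le
      have hsum : ∀ j, ∑ i ∈ Finset.range (n + 1), Function.update u n a i * p i j =
          ∑ i ∈ Finset.range n, u i * p i j + a * p n j := by
        intro j
        rw [Finset.sum_range_succ, Function.update_self]
        congr 1
        refine Finset.sum_congr rfl fun i hi => ?_
        rw [Function.update_of_ne (Finset.mem_range.1 hi).ne]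
      have hupd : ∀ i, 0 ≤ Function.update u n a i := by
        intro i
        by_cases hi : i = n
        · subst hi; simpa using ha0
        · simpa [Function.update_of_ne hi] using hu0 i
      have hlt : ∀ j < n + 1, ∑ i ∈ Finset.range (n + 1), Function.update u n a i * p i j = 1 := by
        intro j hj
        rw [hsum]
        rcases Nat.lt_succ_iff_lt_or_eq.1 hj with h | rfl
        · rw [hzero n j h, hu1 j h]; simp
        · rw [ha, div_mul_cancel₀ _ (hdiag j).ne']; ring
      refine ⟨_, hupd, hlt, fun j => ?_⟩
      rcases lt_or_ge j (n + 1) with h | h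
      · exact (hlt j h).le
      · have : n ≤ j := by omega
        induction j, this using Nat.le_induction with
        | base => exact (hlt n n.lt_succ_self).le
        | succ j hj ih =>
          have hjle : ∑ i ∈ Finset.range (n + 1), Function.update u n a i * p i j ≤ 1 := by
            rcases lt_or_ge j (n + 1) with h' | h'
            · exact (hlt j h').le
            · exact ih h'
          refine le_trans (Finset.sum_le_sum fun i hi => ?_) hjle
          exact mul_le_mul_of_nonneg_left
            (hanti i j (by have := Finset.mem_range.1 hi; omega)) (hupd i)
  obtain ⟨u, hu0, hu1, hule⟩ := key n
  have hW : 0 < ∑ i ∈ Finset.range n, u i := by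
    refine lt_of_le_of_ne (Finset.sum_nonneg fun i _ => hu0 i) fun h => ?_
    have hz := (Finset.sum_eq_zero_iff_of_nonneg fun i _ => hu0 i).1 h.symm
    have := hu1 0 hn
    rw [Finset.sum_eq_zero fun i hi => by rw [hz i hi, zero_mul]] at this
    exact zero_ne_one this
  have hsc : ∀ j, ∑ i ∈ Finset.range n, u i / (∑ i ∈ Finset.range n, u i) * p i j =
      (∑ i ∈ Finset.range n, u i * p i j) / ∑ i ∈ Finset.range n, u i := by
    intro j
    rw [Finset.sum_div]
    exact Finset.sum_congr rfl fun i _ => by ring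
  refine ⟨fun i => u i / ∑ i ∈ Finset.range n, u i, fun i => div_nonneg (hu0 i) hW.le, ?_,
    1 / ∑ i ∈ Finset.range n, u i, one_div_pos.2 hW, fun j hj => ?_, fun j => ?_⟩
  · rw [← Finset.sum_div, div_self hW.ne']
  · rw [hsc, hu1 j hj]
  · rw [hsc]
    exact div_le_div_of_nonneg_right (hule j) hW.le

/-- A finite rotation invariant measure is determined by its image under the norm. -/
theorem ext_of_rotation_invariant {E : Type*} [NormedAddCommGroup E] [InnerProductSpace ℝ E]
    [FiniteDimensional ℝ E] [Nontrivial E] [MeasurableSpace E] [BorelSpace E]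
    {α α' : Measure E} [IsFiniteMeasure α] [IsFiniteMeasure α']
    (hα : ∀ O : E ≃ₗᵢ[ℝ] E, α.map O = α) (hα' : ∀ O : E ≃ₗᵢ[ℝ] E, α'.map O = α')
    (h : α.map (fun x => ‖x‖) = α'.map (fun x => ‖x‖)) : α = α' := by
  obtain ⟨e, he⟩ : ∃ e : E, ‖e‖ = 1 := exists_norm_eq E zero_le_one
  set β : Measure E := volume.restrict (ball (0 : E) 1) with hβ
  have : IsFiniteMeasure β := ⟨by simp [hβ, measure_ball_lt_top]⟩
  have hβ0 : β.real univ ≠ 0 := by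
    rw [measureReal_def, ENNReal.toReal_ne_zero]
    exact ⟨by simpa [hβ] using (measure_ball_pos volume (0 : E) one_pos).ne',
      measure_ne_top _ _⟩
  have hβO : ∀ O : E ≃ₗᵢ[ℝ] E, MeasurePreserving O β β := fun O => by
    have := O.measurePreserving.restrict_preimage (s := ball (0 : E) 1) measurableSet_ball
    simpa [hβ] using this
  let k : ℝ → E → E → ℂ := fun s x y =>
    Complex.exp ((inner ℝ x (s • (‖y‖⁻¹ • y)) : ℝ) * Complex.I)
  let H : ℝ → E → ℂ := fun s x => ∫ y, k s x y ∂β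
  have hkm : ∀ s, StronglyMeasurable (fun z : E × E => k s z.1 z.2) := fun s => by
    refine Measurable.stronglyMeasurable ?_
    fun_prop
  have hk1 : ∀ s x y, ‖k s x y‖ = 1 := fun s x y => Complex.norm_exp_ofReal_mul_I _
  have hHm : ∀ s, StronglyMeasurable (H s) := fun s => (hkm s).integral_prod_right
  have hHO : ∀ s (O : E ≃ₗᵢ[ℝ] E) x, H s (O x) = H s x := by
    intro s O x
    change ∫ y, k s (O x) y ∂β = ∫ y, k s x y ∂β
    rw [← (hβO O).integral_comp O.toHomeomorph.measurableEmbedding (k s (O x))]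
    refine integral_congr_ae (Eventually.of_forall fun y => ?_)
    have : s • (‖O y‖⁻¹ • O y) = O (s • (‖y‖⁻¹ • y)) := by simp
    simp only [k, this, O.inner_map_map]
  have hHn : ∀ s x, H s x = H s (‖x‖ • e) := by
    intro s x
    have : ‖‖x‖ • e‖ = ‖x‖ := by simp [norm_smul, he]
    rw [← hHO s (Submodule.reflection (ℝ ∙ (‖x‖ • e - x))ᗮ) (‖x‖ • e),
      Submodule.reflection_sub this]
  have key : ∀ (γ : Measure E) [IsFiniteMeasure γ], (∀ O : E ≃ₗᵢ[ℝ] E, γ.map O = γ) → ∀ t,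
      β.real univ • charFun γ t = ∫ s, H ‖t‖ (s • e) ∂(γ.map fun x => ‖x‖) := by
    intro γ _ hγ t
    have hrot : ∀ t', ‖t'‖ = ‖t‖ → charFun γ t' = charFun γ t := by
      intro t' ht
      set O := Submodule.reflection (ℝ ∙ (t - t'))ᗮ
      have hO : O t = t' := Submodule.reflection_sub ht.symm
      rw [charFun_apply, charFun_apply, ← hO]
      conv_lhs => rw [← hγ O]
      rw [integral_map O.continuous.measurable.aemeasurable (by fun_prop)]
      simp only [O.inner_map_map]
    have hae : ∀ᵐ y ∂β, charFun γ (‖t‖ • (‖y‖⁻¹ • y)) = charFun γ t := by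
      have h0 : ∀ᵐ y ∂β, y ≠ 0 := by
        refine ae_restrict_of_ae ?_
        simp [ae_iff]
      filter_upwards [h0] with y hy
      refine hrot _ ?_
      rw [norm_smul, norm_smul, norm_norm, norm_inv, norm_norm,
        inv_mul_cancel₀ (norm_ne_zero_iff.2 hy), mul_one]
    have hHe : StronglyMeasurable fun s : ℝ => H ‖t‖ (s • e) :=
      (hHm ‖t‖).comp_measurable (by fun_prop)
    rw [integral_map continuous_norm.measurable.aemeasurable hHe.aestronglyMeasurable]
    simp_rw [← hHn]
    calc β.real univ • charFun γ t = ∫ y, charFun γ (‖t‖ • (‖y‖⁻¹ • y)) ∂β := by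
          rw [integral_congr_ae hae, integral_const]
      _ = ∫ y, ∫ x, k ‖t‖ x y ∂γ ∂β := by simp only [charFun_apply, k]
      _ = ∫ x, H ‖t‖ x ∂γ := by
          rw [integral_integral_swap]
          refine Integrable.of_bound
            ((hkm ‖t‖).comp_measurable measurable_swap).aestronglyMeasurable 1
            (Eventually.of_forall fun z => (hk1 _ _ _).le)
  refine Measure.ext_of_charFun (funext fun t => ?_)
  refine smul_right_injective ℂ hβ0 ?_
  simp only [key α hα t, key α' hα' t, h]

/-- The mean densities of `ρ` with respect to `lam` are non-increasing on `(r, ∞)`: sets to the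
left have a larger mean density than sets to the right. -/
def HasDecreasingMeans (lam ρ : Measure ℝ) (r : ℝ) : Prop :=
  ∀ s, r < s → ∀ A B, MeasurableSet A → MeasurableSet B → A ⊆ Ioc r s → B ⊆ Ici s →
    ρ B * lam A ≤ ρ A * lam B

theorem HasDecreasingMeans.Ico_le {lam ρ : Measure ℝ} [NullSingletonClass lam] {r a b e : ℝ}
    (h : HasDecreasingMeans lam ρ r) (hra : r ≤ a) (hab : a < b) :
    ρ (Ico b e) * lam (Ico a b) ≤ ρ (Ico a b) * lam (Ico b e) := by
  have := h b (hra.trans_lt hab) (Ioo a b) (Ico b e) measurableSet_Ioo measurableSet_Ico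
    (fun x hx => ⟨hra.trans_lt hx.1, hx.2.le⟩) Ico_subset_Ici_self
  rw [measure_congr (Ioo_ae_eq_Ico (μ := lam))] at this
  exact this.trans (by gcongr; exact Ioo_subset_Ico_self)

/-- A measure dominated by `C • lam` on closed intervals is dominated by `C • lam`. -/
theorem measure_le_smul_of_Icc_le {lam M : Measure ℝ} [IsLocallyFiniteMeasure lam]
    [IsFiniteMeasure M] {C : ℝ≥0∞} (hC : C ≠ ∞)
    (hle : ∀ a b, M (Icc a b) ≤ C * lam (Icc a b)) : M ≤ C • lam := by
  have : IsLocallyFiniteMeasure (C • lam) := by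
    lift C to NNReal using hC
    exact inferInstanceAs (IsLocallyFiniteMeasure (C • lam))
  refine Measure.le_intro fun s _ _ => ?_
  refine (Besicovitch.vitaliFamily M).measure_le_of_frequently_le (C • lam)
    Measure.AbsolutelyContinuous.rfl s fun x _ => ?_
  refine (Besicovitch.tendsto_filterAt M x).frequently (Eventually.of_forall fun ε => ?_).frequently
  rw [Real.closedBall_eq_Icc]
  exact hle _ _

theorem hasDecreasingMeans_mixture {lam : Measure ℝ} {q : ℝ} {ρ : Icc q 1 → ProbabilityMeasure ℝ}
    (m : ProbabilityMeasure (Icc q 1)) (hρ : Continuous ρ)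
    (hdec : ∀ x : Icc q 1, HasDecreasingMeans lam (ρ x) x) :
    HasDecreasingMeans lam (mixture m ρ hρ) 1 := by
  intro s hs A B hA hB hAs hBs
  have hmeas : ∀ {S : Set ℝ}, MeasurableSet S → Measurable fun y => (ρ y : Measure ℝ) S :=
    fun hS => (Measure.measurable_coe hS).comp (measurable_of_continuous_probabilityMeasure hρ)
  rw [mixture_apply m hρ hA, mixture_apply m hρ hB, ← lintegral_mul_const _ (hmeas hA),
    ← lintegral_mul_const _ (hmeas hB)]
  exact lintegral_mono fun x => hdec x s (x.2.2.trans_lt hs) A B hA hB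
    (hAs.trans (Ioc_subset_Ioc_left x.2.2)) hBs

section OneDimensional

variable {lam : Measure ℝ} [NullSingletonClass lam] [IsLocallyFiniteMeasure lam] {q : ℝ}
  {ρ : Icc q 1 → ProbabilityMeasure ℝ}

theorem mixture_Iio_eq_zero (m : ProbabilityMeasure (Icc q 1)) (hρ : Continuous ρ)
    (hsupp : ∀ x, (ρ x : Measure ℝ) (Iio x) = 0) :
    (mixture m ρ hρ : Measure ℝ) (Iio q) = 0 := by
  rw [mixture_apply m hρ measurableSet_Iio]
  exact (lintegral_congr fun x => measure_mono_null (Iio_subset_Iio x.2.1) (hsupp x)).trans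
    lintegral_zero

/-- The discrete averaging step on the grid of step `δ = (1 - q) / n`. -/
theorem exists_mixture_grid (hpos : ∀ a b, q ≤ a → a < b → 0 < lam (Ioo a b)) (hq1 : q < 1)
    (hρ : Continuous ρ) (hsupp : ∀ x, (ρ x : Measure ℝ) (Iio x) = 0)
    (hdec : ∀ x : Icc q 1, HasDecreasingMeans lam (ρ x) x) {n : ℕ} (hn : 0 < n) {δ : ℝ}
    (hδ : n * δ = 1 - q) :
    ∃ m : ProbabilityMeasure (Icc q 1), ∃ c : ℝ, 0 < c ∧
      (∀ j : ℕ, (mixture m ρ hρ : Measure ℝ) (Ico (q + j * δ) (q + (j + 1 : ℕ) * δ)) ≤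
        ENNReal.ofReal c * lam (Ico (q + j * δ) (q + (j + 1 : ℕ) * δ))) ∧
      ∀ j < n, (mixture m ρ hρ : Measure ℝ) (Ico (q + j * δ) (q + (j + 1 : ℕ) * δ)) =
        ENNReal.ofReal c * lam (Ico (q + j * δ) (q + (j + 1 : ℕ) * δ)) := by
  have hn' : (0 : ℝ) < n := by exact_mod_cast hn
  have hδ0 : 0 < δ := by
    by_contra hcon
    nlinarith
  have hmono : Monotone fun j : ℕ => q + j * δ := fun i j hij => by
    have : (i : ℝ) ≤ j := by exact_mod_cast hij
    dsimp only
    gcongr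
  set I : ℕ → Set ℝ := fun j => Ico (q + j * δ) (q + (j + 1 : ℕ) * δ)
  have hlam0 : ∀ j, lam (I j) ≠ 0 := fun j => by
    refine ((hpos _ _ ?_ ?_).trans_le (measure_mono Ioo_subset_Ico_self)).ne'
    · have : 0 ≤ (j : ℝ) * δ := by positivity
      linarith
    · push_cast; linarith
  have hlamt : ∀ j, lam (I j) ≠ ∞ := fun j => measure_Ico_lt_top.ne
  have hlampos : ∀ j, 0 < lam.real (I j) := fun j => ENNReal.toReal_pos (hlam0 j) (hlamt j)
  have hmem : ∀ i < n, q + i * δ ∈ Icc q 1 := fun i hi => by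
    have : (i : ℝ) < n := by exact_mod_cast hi
    constructor
    · have : 0 ≤ (i : ℝ) * δ := by positivity
      linarith
    · nlinarith
  let x : ℕ → Icc q 1 := fun i => if hi : i < n then ⟨_, hmem i hi⟩ else ⟨q, le_rfl, hq1.le⟩
  have hx : ∀ i < n, (x i : ℝ) = q + i * δ := fun i hi => by simp [x, hi]
  -- Rows beyond the first `n` are irrelevant and replaced by indicators of `{j | i ≤ j}`.
  let p : ℕ → ℕ → ℝ := fun i j => if i < n then (ρ (x i) : Measure ℝ).real (I j) / lam.real (I j)
    else if j < i then 0 else 1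
  have hstep : ∀ i < n, ∀ j, i ≤ j → p i (j + 1) ≤ p i j := by
    intro i hi j hij
    simp only [p, if_pos hi]
    rw [div_le_div_iff₀ (hlampos _) (hlampos _)]
    have := (hdec (x i)).Ico_le (a := q + j * δ) (b := q + (j + 1 : ℕ) * δ)
      (e := q + (j + 1 + 1 : ℕ) * δ) (by rw [hx i hi]; exact hmono hij)
      (by push_cast; linarith)
    have h2 := ENNReal.toReal_mono (ENNReal.mul_ne_top (measure_ne_top _ _) (hlamt (j + 1))) this
    rw [ENNReal.toReal_mul, ENNReal.toReal_mul] at h2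
    exact h2
  obtain ⟨w, hw0, hw1, c, hc, heq, hle⟩ := exists_weights_of_triangular p
    (by
      intro i j hji
      by_cases hi : i < n
      · have : (ρ (x i) : Measure ℝ) (I j) = 0 := by
          refine measure_mono_null (fun y hy => ?_) (hsupp (x i))
          rw [mem_Iio, hx i hi]
          exact hy.2.trans_le (hmono hji)
        simp [p, hi, measureReal_def, this]
      · simp [p, hi, hji])
    (by
      intro i
      by_cases hi : i < n
      · have h0 : 0 ≤ p i i := by
          simp only [p, if_pos hi]; positivity
        refine lt_of_le_of_ne h0 fun hzero => ?_
        have hall : ∀ j, i ≤ j → p i j ≤ 0 := by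
          intro j hij
          induction j, hij using Nat.le_induction with
          | base => exact hzero.ge
          | succ j hj ih => exact (hstep i hi j hj).trans ih
        have hnull : ∀ j, (ρ (x i) : Measure ℝ) (I (i + j)) = 0 := by
          intro j
          have := hall (i + j) (Nat.le_add_right _ _)
          simp only [p, if_pos hi] at this
          rw [div_le_iff₀ (hlampos _), zero_mul] at this
          exact (measureReal_eq_zero_iff).1 (le_antisymm this measureReal_nonneg)
        have huniv : (univ : Set ℝ) ⊆ Iio (x i : ℝ) ∪ ⋃ j, I (i + j) := by
          intro y _
          rcases lt_or_ge y (x i : ℝ) with hy | hy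
          · exact Or.inl hy
          · right
            rw [hx i hi] at hy
            have hy' : (i : ℝ) ≤ (y - q) / δ := by rw [le_div_iff₀ hδ0]; linarith
            have h0 : 0 ≤ (y - q) / δ := (Nat.cast_nonneg i).trans hy'
            have hfl := Nat.floor_le h0
            have hfl' := Nat.lt_floor_add_one ((y - q) / δ)
            rw [le_div_iff₀ hδ0] at hfl
            rw [div_lt_iff₀ hδ0] at hfl'
            refine mem_iUnion.2 ⟨⌊(y - q) / δ⌋₊ - i, ?_⟩
            rw [Nat.add_sub_cancel' (Nat.le_floor hy')]
            refine ⟨by linarith, ?_⟩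
            push_cast
            linarith
        have : (ρ (x i) : Measure ℝ) univ = 0 :=
          measure_mono_null huniv (measure_union_null (hsupp _) (measure_iUnion_null hnull))
        simp at this
      · simp [p, hi])
    (by
      intro i j hij
      by_cases hi : i < n
      · exact hstep i hi j hij
      · simp [p, hi, hij.not_gt, (Nat.lt_succ_of_le hij).not_gt])
    n hn
  let m : Measure (Icc q 1) := ∑ i ∈ Finset.range n, ENNReal.ofReal (w i) • Measure.dirac (x i)
  have hm : IsProbabilityMeasure m := ⟨by
    simp only [m, Measure.coe_finsetSum, Finset.sum_apply, Measure.smul_apply, measure_univ,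
      smul_eq_mul, mul_one]
    rw [← ENNReal.ofReal_sum_of_nonneg fun i _ => hw0 i, hw1, ENNReal.ofReal_one]⟩
  let m' : ProbabilityMeasure (Icc q 1) := ⟨m, hm⟩
  have hIm : ∀ j, MeasurableSet (I j) := fun j => measurableSet_Ico
  have hmix : ∀ j, (mixture m' ρ hρ : Measure ℝ) (I j) =
      ENNReal.ofReal (∑ i ∈ Finset.range n, w i * p i j) * lam (I j) := by
    intro j
    rw [mixture_apply m' hρ (hIm j)]
    simp only [m', ProbabilityMeasure.coe_mk, m, lintegral_finsetSum_measure, lintegral_smul_measure,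
      smul_eq_mul]
    rw [ENNReal.ofReal_sum_of_nonneg, Finset.sum_mul]
    · refine Finset.sum_congr rfl fun i hi => ?_
      have hi' := Finset.mem_range.1 hi
      have hmeas : Measurable fun y => (ρ y : Measure ℝ) (I j) :=
        (Measure.measurable_coe (hIm j)).comp (measurable_of_continuous_probabilityMeasure hρ)
      rw [lintegral_dirac' _ hmeas, ENNReal.ofReal_mul (hw0 i), mul_assoc]
      congr 1
      simp only [p, if_pos hi']
      rw [ENNReal.ofReal_div_of_pos (hlampos j), ofReal_measureReal,
        ofReal_measureReal (hlamt j), ENNReal.div_mul_cancel (hlam0 j) (hlamt j)]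
    · intro i hi
      have hi' := Finset.mem_range.1 hi
      simp only [p, if_pos hi']
      have := hw0 i
      positivity
  refine ⟨m', c, hc, fun j => ?_, fun j hj => ?_⟩
  · exact (hmix j).trans_le (by gcongr; exact hle j)
  · exact (hmix j).trans (by rw [heq j hj])

/-- Version of the discrete averaging step for arbitrary intervals. -/
theorem exists_mixture_almost_uniform (hpos : ∀ a b, q ≤ a → a < b → 0 < lam (Ioo a b))
    (hq1 : q < 1) (hρ : Continuous ρ) (hsupp : ∀ x, (ρ x : Measure ℝ) (Iio x) = 0)
    (hdec : ∀ x : Icc q 1, HasDecreasingMeans lam (ρ x) x) {n : ℕ} (hn : 0 < n) {δ : ℝ}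
    (hδ : n * δ = 1 - q) :
    ∃ m : ProbabilityMeasure (Icc q 1), ∃ c : ℝ, 0 < c ∧
      (∀ a b, (mixture m ρ hρ : Measure ℝ) (Ioo a b) ≤
        ENNReal.ofReal c * lam (Icc (a - δ) (b + δ))) ∧
      ∀ a b, q ≤ a → b ≤ 1 →
        ENNReal.ofReal c * lam (Icc (a + δ) (b - δ)) ≤ (mixture m ρ hρ : Measure ℝ) (Icc a b) := by
  have hn' : (0 : ℝ) < n := by exact_mod_cast hn
  have hδ0 : 0 < δ := by
    by_contra hcon
    nlinarith
  obtain ⟨m, c, hc, hle, heq⟩ := exists_mixture_grid hpos hq1 hρ hsupp hdec hn hδ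
  set M := (mixture m ρ hρ : Measure ℝ)
  have hmono : Monotone fun j : ℕ => q + j * δ := fun i j hij => by
    have : (i : ℝ) ≤ j := by exact_mod_cast hij
    dsimp only
    gcongr
  have hsplit : ∀ (ν : Measure ℝ) (j k : ℕ), j ≤ k → ν (Ico (q + j * δ) (q + (k + 1 : ℕ) * δ)) =
      ν (Ico (q + j * δ) (q + k * δ)) + ν (Ico (q + k * δ) (q + (k + 1 : ℕ) * δ)) := by
    intro ν j k hjk
    rw [← Ico_union_Ico_eq_Ico (hmono hjk) (hmono k.le_succ),
      measure_union (Ico_disjoint_Ico_same) measurableSet_Ico]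
  have hle' : ∀ j k : ℕ, M (Ico (q + j * δ) (q + k * δ)) ≤
      ENNReal.ofReal c * lam (Ico (q + j * δ) (q + k * δ)) := by
    intro j k
    rcases lt_or_ge k j with h | h
    · simp [Ico_eq_empty_of_le (hmono h.le)]
    · induction k, h using Nat.le_induction with
      | base => simp
      | succ k hk ih =>
        rw [hsplit M j k hk, hsplit lam j k hk, mul_add]
        exact add_le_add ih (hle k)
  have hge' : ∀ j k : ℕ, k ≤ n → ENNReal.ofReal c * lam (Ico (q + j * δ) (q + k * δ)) ≤
      M (Ico (q + j * δ) (q + k * δ)) := by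
    intro j k hkn
    rcases lt_or_ge k j with h | h
    · simp [Ico_eq_empty_of_le (hmono h.le)]
    · induction k, h using Nat.le_induction with
      | base => simp
      | succ k hk ih =>
        rw [hsplit M j k hk, hsplit lam j k hk, mul_add]
        exact add_le_add (ih (by omega)) (heq k (by omega)).ge
  have hMq : M (Iio q) = 0 := mixture_Iio_eq_zero m hρ hsupp
  refine ⟨m, c, hc, fun a b => ?_, fun a b ha hb => ?_⟩
  · set j := ⌊(a - q) / δ⌋₊ with hj
    set k := ⌈(b - q) / δ⌉₊ with hk
    have h1 : Ioo a b ⊆ Iio q ∪ Ico (q + j * δ) (q + k * δ) := by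
      intro y hy
      rcases lt_or_ge y q with hyq | hyq
      · exact Or.inl hyq
      · refine Or.inr ⟨?_, ?_⟩
        · rcases lt_or_ge a q with haq | haq
          · have : j = 0 := Nat.floor_of_nonpos (div_nonpos_of_nonpos_of_nonneg (by linarith) hδ0.le)
            simpa [this] using hyq
          · have := Nat.floor_le (div_nonneg (sub_nonneg.2 haq) hδ0.le)
            rw [← hj, le_div_iff₀ hδ0] at this
            linarith [hy.1]
        · have := Nat.le_ceil ((b - q) / δ)
          rw [← hk, div_le_iff₀ hδ0] at this
          linarith [hy.2]
    have h2 : Ico (q + j * δ) (q + k * δ) ⊆ Icc (a - δ) (b + δ) := by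
      intro y hy
      have hj' := Nat.lt_floor_add_one ((a - q) / δ)
      rw [← hj, div_lt_iff₀ hδ0] at hj'
      refine ⟨by linarith [hy.1], ?_⟩
      have hbq : 0 ≤ (b - q) / δ := by
        by_contra hcon
        have hk0 : k = 0 := Nat.ceil_eq_zero.2 (not_le.1 hcon).le
        have h3 : q + (j : ℝ) * δ < q := by simpa [hk0] using hy.1.trans_lt hy.2
        have : 0 ≤ (j : ℝ) * δ := by positivity
        linarith
      have hk' := Nat.ceil_lt_add_one hbq
      rw [← hk, ← sub_lt_iff_lt_add, lt_div_iff₀ hδ0] at hk'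
      linarith [hy.2]
    calc M (Ioo a b) ≤ M (Iio q) + M (Ico (q + j * δ) (q + k * δ)) :=
          (measure_mono h1).trans (measure_union_le _ _)
      _ ≤ ENNReal.ofReal c * lam (Ico (q + j * δ) (q + k * δ)) := by
          rw [hMq, zero_add]; exact hle' j k
      _ ≤ _ := by gcongr
  · rcases lt_or_ge (b - δ) (a + δ) with hlt | hge
    · simp [Icc_eq_empty_of_lt hlt]
    set j := ⌈(a - q) / δ⌉₊ with hj
    set k := ⌊(b - q) / δ⌋₊ with hk
    have hj1 := Nat.le_ceil ((a - q) / δ)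
    have hj2 := Nat.ceil_lt_add_one (div_nonneg (sub_nonneg.2 ha) hδ0.le)
    have hk1 := Nat.floor_le (div_nonneg (by linarith : 0 ≤ b - q) hδ0.le)
    have hk2 := Nat.lt_floor_add_one ((b - q) / δ)
    rw [← hj, div_le_iff₀ hδ0] at hj1
    rw [← hj, ← sub_lt_iff_lt_add, lt_div_iff₀ hδ0] at hj2
    rw [← hk, le_div_iff₀ hδ0] at hk1
    rw [← hk, div_lt_iff₀ hδ0] at hk2
    have hkn : k ≤ n := by
      have : (k : ℝ) * δ ≤ n * δ := by linarith
      exact_mod_cast le_of_mul_le_mul_right this hδ0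
    have h1 : Icc (a + δ) (b - δ) ⊆ Ico (q + j * δ) (q + k * δ) := fun y hy =>
      ⟨by linarith [hy.1], by linarith [hy.2]⟩
    have h2 : Ico (q + j * δ) (q + k * δ) ⊆ Icc a b := fun y hy =>
      ⟨by linarith [hy.1], by linarith [hy.2]⟩
    calc _ ≤ ENNReal.ofReal c * lam (Ico (q + j * δ) (q + k * δ)) := by gcongr
      _ ≤ M (Ico (q + j * δ) (q + k * δ)) := hge' j k hkn
      _ ≤ M (Icc a b) := measure_mono h2

/-- Some mixture coincides with a multiple of `lam` on `[q, 1]`, and is dominated by it on all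
intervals. -/
theorem exists_mixture_uniform (hpos : ∀ a b, q ≤ a → a < b → 0 < lam (Ioo a b))
    (hq1 : q < 1) (hρ : Continuous ρ) (hsupp : ∀ x, (ρ x : Measure ℝ) (Iio x) = 0)
    (hdec : ∀ x : Icc q 1, HasDecreasingMeans lam (ρ x) x) :
    ∃ m : ProbabilityMeasure (Icc q 1), ∃ c : ℝ,
      (∀ a b, (mixture m ρ hρ : Measure ℝ) (Icc a b) ≤ ENNReal.ofReal c * lam (Icc a b)) ∧
      ∀ a b, q ≤ a → b ≤ 1 →
        ENNReal.ofReal c * lam (Icc a b) ≤ (mixture m ρ hρ : Measure ℝ) (Icc a b) := by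
  set δ : ℕ → ℝ := fun n => (1 - q) / (n + 4 : ℕ) with hδ
  have hδle : ∀ n, δ n ≤ (1 - q) / 4 := fun n => by
    refine div_le_div_of_nonneg_left (by linarith) (by norm_num) ?_
    push_cast
    linarith [(Nat.cast_nonneg n : (0 : ℝ) ≤ n)]
  have hδlim : Tendsto δ atTop (𝓝 0) :=
    (tendsto_const_div_atTop_nhds_zero_nat (1 - q)).comp (tendsto_add_atTop_nat 4)
  have hstep : ∀ n, _ := fun n => exists_mixture_almost_uniform hpos hq1 hρ hsupp hdec
    (n := n + 4) (δ := δ n) (by omega) (mul_div_cancel₀ _ (by positivity))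
  choose m c hc hle hge using hstep
  set J := Icc (q + (1 - q) / 4) (1 - (1 - q) / 4) with hJ
  have hJ0 : 0 < lam.real J := by
    refine ENNReal.toReal_pos ?_ isCompact_Icc.measure_lt_top.ne
    exact ((hpos (q + (1 - q) / 4) (1 - (1 - q) / 4) (by linarith) (by linarith)).trans_le
      (measure_mono Ioo_subset_Icc_self)).ne'
  have hcC : ∀ n, c n ∈ Icc 0 (1 / lam.real J) := fun n => by
    refine ⟨(hc n).le, (le_div_iff₀ hJ0).2 ?_⟩
    have h1 : ENNReal.ofReal (c n) * lam J ≤ 1 := by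
      refine le_trans ?_ ((hge n q 1 le_rfl le_rfl).trans prob_le_one)
      gcongr
      exact Icc_subset_Icc (by linarith [hδle n]) (by linarith [hδle n])
    have h2 := ENNReal.toReal_mono ENNReal.one_ne_top h1
    rwa [ENNReal.toReal_mul, ENNReal.toReal_ofReal (hc n).le, ENNReal.toReal_one] at h2
  obtain ⟨c₀, -, φ, hφ, hφc⟩ := isCompact_Icc.tendsto_subseq hcC
  obtain ⟨m₀, ψ, hψ, hψm⟩ := CompactSpace.tendsto_subseq (m ∘ φ)
  set θ : ℕ → ℕ := fun n => φ (ψ n) with hθ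
  have hθt : Tendsto θ atTop atTop := hφ.tendsto_atTop.comp hψ.tendsto_atTop
  have hMlim : Tendsto (fun n => mixture (m (θ n)) ρ hρ) atTop (𝓝 (mixture m₀ ρ hρ)) :=
    ((continuous_mixture hρ).tendsto m₀).comp hψm
  have hclim : ∀ A : Set ℝ, lam A ≠ ∞ → Tendsto (fun n => ENNReal.ofReal (c (θ n)) * lam A) atTop
      (𝓝 (ENNReal.ofReal c₀ * lam A)) := fun A hA =>
    ENNReal.Tendsto.mul_const ((ENNReal.continuous_ofReal.tendsto c₀).comp
      (hφc.comp hψ.tendsto_atTop)) (Or.inr hA)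
  have hsmall : ∀ η > 0, ∀ᶠ n in atTop, δ (θ n) ≤ η := fun η hη =>
    ((hδlim.comp hθt).eventually (gt_mem_nhds hη)).mono fun n hn => le_of_lt hn
  refine ⟨m₀, c₀, fun a b => ?_, fun a b ha hb => ?_⟩
  · have hη : ∀ η > 0, (mixture m₀ ρ hρ : Measure ℝ) (Icc a b) ≤
        ENNReal.ofReal c₀ * lam (Icc (a - 2 * η) (b + 2 * η)) := by
      intro η hη
      calc (mixture m₀ ρ hρ : Measure ℝ) (Icc a b)
          ≤ (mixture m₀ ρ hρ : Measure ℝ) (Ioo (a - η) (b + η)) :=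
            measure_mono fun y hy => ⟨by linarith [hy.1], by linarith [hy.2]⟩
        _ ≤ liminf (fun n => (mixture (m (θ n)) ρ hρ : Measure ℝ) (Ioo (a - η) (b + η))) atTop :=
            ProbabilityMeasure.le_liminf_measure_open_of_tendsto hMlim isOpen_Ioo
        _ ≤ liminf (fun n => ENNReal.ofReal (c (θ n)) * lam (Icc (a - 2 * η) (b + 2 * η)))
              atTop := by
            refine liminf_le_liminf ((hsmall η hη).mono fun n hn => ?_)
            have hsub : Icc (a - η - δ (θ n)) (b + η + δ (θ n)) ⊆
                Icc (a - 2 * η) (b + 2 * η) := Icc_subset_Icc (by linarith) (by linarith)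
            exact (hle (θ n) (a - η) (b + η)).trans (mul_le_mul' le_rfl (measure_mono hsub))
        _ = _ := (hclim _ isCompact_Icc.measure_lt_top.ne).liminf_eq
    have hinter : Icc a b = ⋂ η > (0 : ℝ), Icc (a - 2 * η) (b + 2 * η) := by
      ext y
      simp only [mem_iInter, mem_Icc]
      refine ⟨fun h η hη => ⟨by linarith, by linarith⟩, fun h => ⟨?_, ?_⟩⟩
      · exact le_of_forall_pos_le_add fun ε hε => by linarith [(h (ε / 2) (by linarith)).1]
      · exact le_of_forall_pos_le_add fun ε hε => by linarith [(h (ε / 2) (by linarith)).2]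
    have hlim : Tendsto (fun η : ℝ => lam (Icc (a - 2 * η) (b + 2 * η))) (𝓝[>] 0)
        (𝓝 (lam (Icc a b))) := by
      rw [hinter]
      exact tendsto_measure_biInter_gt (fun η _ => measurableSet_Icc.nullMeasurableSet)
        (fun i j _ hij => Icc_subset_Icc (by linarith) (by linarith))
        ⟨1, one_pos, isCompact_Icc.measure_lt_top.ne⟩
    refine ge_of_tendsto (ENNReal.Tendsto.const_mul hlim (Or.inr ENNReal.ofReal_ne_top))
      (eventually_mem_nhdsWithin.mono fun η hη' => hη η hη')
  · have hη : ∀ n : ℕ, ENNReal.ofReal c₀ * lam (Icc (a + 1 / (n + 1 : ℝ)) (b - 1 / (n + 1 : ℝ))) ≤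
        (mixture m₀ ρ hρ : Measure ℝ) (Icc a b) := by
      intro k
      have hη0 : 0 < 1 / (k + 1 : ℝ) := by positivity
      set η := 1 / (k + 1 : ℝ)
      calc _ = limsup (fun n => ENNReal.ofReal (c (θ n)) * lam (Icc (a + η) (b - η))) atTop :=
            (hclim _ isCompact_Icc.measure_lt_top.ne).limsup_eq.symm
        _ ≤ limsup (fun n => (mixture (m (θ n)) ρ hρ : Measure ℝ) (Icc a b)) atTop := by
            refine limsup_le_limsup ((hsmall η hη0).mono fun n hn => ?_)
            have hsub : Icc (a + η) (b - η) ⊆ Icc (a + δ (θ n)) (b - δ (θ n)) :=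
              Icc_subset_Icc (by linarith) (by linarith)
            exact (mul_le_mul' le_rfl (measure_mono hsub)).trans (hge (θ n) a b ha hb)
        _ ≤ _ := ProbabilityMeasure.limsup_measure_closed_le_of_tendsto hMlim isClosed_Icc
    have hunion : Ioo a b = ⋃ n : ℕ, Icc (a + 1 / (n + 1 : ℝ)) (b - 1 / (n + 1 : ℝ)) := by
      ext y
      simp only [mem_iUnion, mem_Icc, mem_Ioo]
      constructor
      · rintro ⟨h1, h2⟩
        obtain ⟨n, hn⟩ := exists_nat_one_div_lt (lt_min (sub_pos.2 h1) (sub_pos.2 h2))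
        exact ⟨n, by linarith [hn.trans_le (min_le_left _ _)],
          by linarith [hn.trans_le (min_le_right _ _)]⟩
      · rintro ⟨n, h1, h2⟩
        have : 0 < 1 / (n + 1 : ℝ) := by positivity
        exact ⟨by linarith, by linarith⟩
    have hmono : Monotone fun n : ℕ => Icc (a + 1 / (n + 1 : ℝ)) (b - 1 / (n + 1 : ℝ)) := by
      intro i j hij
      have := Nat.one_div_le_one_div (α := ℝ) hij
      exact Icc_subset_Icc (by linarith) (by linarith)
    have hlim : Tendsto (fun n : ℕ => lam (Icc (a + 1 / (n + 1 : ℝ)) (b - 1 / (n + 1 : ℝ)))) atTop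
        (𝓝 (lam (Icc a b))) := by
      rw [← measure_congr (Ioo_ae_eq_Icc (μ := lam)), hunion]
      exact tendsto_measure_iUnion_atTop hmono
    exact le_of_tendsto' (ENNReal.Tendsto.const_mul hlim (Or.inr ENNReal.ofReal_ne_top)) hη

/-- A measure with decreasing means on `(1, ∞)` that is dominated by `C • lam`, with equality on
`[q, 1]`, and vanishes below `q` has a non-increasing density on `[q, ∞)`. -/
theorem exists_antitone_density {M : Measure ℝ} [IsFiniteMeasure M] {C : ℝ≥0∞} (hC : C ≠ ∞)
    (hpos : ∀ a b, q ≤ a → a < b → 0 < lam (Ioo a b)) (hq1 : q < 1) (hM : M (Iio q) = 0)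
    (hle : ∀ a b, M (Icc a b) ≤ C * lam (Icc a b))
    (hge : ∀ a b, q ≤ a → b ≤ 1 → C * lam (Icc a b) ≤ M (Icc a b))
    (hdec : HasDecreasingMeans lam M 1) :
    ∃ G : ℝ → ℝ≥0∞, Antitone G ∧ (∀ t ≤ 1, G t = C) ∧ M = lam.withDensity ((Ici q).indicator G) := by
  set D : ℝ → ℝ → ℝ≥0∞ := fun t ε => M (closedBall t ε) / lam (closedBall t ε) with hD
  set G : ℝ → ℝ≥0∞ := fun t => if t ≤ 1 then C else min C (limsup (D t) (𝓝[>] 0)) with hG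
  have hball0 : ∀ t ε, q ≤ t → 0 < ε → lam (closedBall t ε) ≠ 0 := fun t ε ht hε => by
    refine ((hpos t (t + ε) ht (by linarith)).trans_le (measure_mono ?_)).ne'
    rw [Real.closedBall_eq_Icc]
    exact fun y hy => ⟨by linarith [hy.1], hy.2.le⟩
  have hballt : ∀ t ε, lam (closedBall t ε) ≠ ∞ := fun t ε =>
    (isCompact_closedBall t ε).measure_lt_top.ne
  have hDle : ∀ t ε, D t ε ≤ C := fun t ε => by
    refine ENNReal.div_le_of_le_mul ?_
    rw [Real.closedBall_eq_Icc]
    exact hle _ _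
  have hsmall : ∀ {a : ℝ}, 0 < a → ∀ᶠ ε in 𝓝[>] (0 : ℝ), 0 < ε ∧ ε < a := fun ha =>
    Ioo_mem_nhdsGT ha
  have hGC : ∀ t, G t ≤ C := fun t => by
    simp only [hG]
    split_ifs
    exacts [le_rfl, min_le_left _ _]
  have hanti : Antitone G := by
    intro s t hst
    by_cases hs : s ≤ 1
    · exact (hGC t).trans_eq (by simp [hG, hs])
    rcases hst.eq_or_lt with rfl | hst
    · exact le_rfl
    push Not at hs
    simp only [hG, hs.not_ge, (hs.trans hst).not_ge, if_false]
    refine min_le_min_left _ (limsup_le_limsup ?_)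
    filter_upwards [hsmall (lt_min (sub_pos.2 hs) (half_pos (sub_pos.2 hst)))] with ε ⟨hε0, hε⟩
    have hε1 := hε.trans_le (min_le_left _ _)
    have hε2 := hε.trans_le (min_le_right _ _)
    have key := hdec ((s + t) / 2) (by linarith) (closedBall s ε) (closedBall t ε)
      measurableSet_closedBall measurableSet_closedBall
      (by rw [Real.closedBall_eq_Icc]; exact fun y hy => ⟨by linarith [hy.1], by linarith [hy.2]⟩)
      (by rw [Real.closedBall_eq_Icc]; exact fun y hy => by rw [mem_Ici]; linarith [hy.1])
    have hs0 := hball0 s ε (by linarith) hε0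
    have ht0 := hball0 t ε (by linarith) hε0
    simp only [hD]
    rw [ENNReal.div_le_iff ht0 (hballt _ _), ENNReal.mul_comm_div, ← mul_div_assoc,
      ENNReal.le_div_iff_mul_le (Or.inl hs0) (Or.inl (hballt _ _))]
    exact key
  have hac : M ≪ lam :=
    (measure_le_smul_of_Icc_le hC hle).absolutelyContinuous.trans
      (Measure.smul_absolutelyContinuous)
  refine ⟨G, hanti, fun t ht => by simp [hG, ht], ?_⟩
  rw [← Measure.withDensity_rnDeriv_eq M lam hac]
  refine withDensity_congr_ae ?_
  have hne : ∀ a : ℝ, ∀ᵐ x ∂lam, x ≠ a := fun a => by simp [ae_iff]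
  filter_upwards [Besicovitch.ae_tendsto_rnDeriv M lam, hne q, hne 1] with x hx hxq hx1
  rcases lt_or_gt_of_ne hxq with hxq | hxq
  · rw [indicator_of_notMem (by simpa using hxq)]
    refine tendsto_nhds_unique hx (tendsto_const_nhds.congr' ?_)
    filter_upwards [hsmall (sub_pos.2 hxq)] with ε ⟨_, hε⟩
    rw [measure_mono_null _ hM, ENNReal.zero_div]
    rw [Real.closedBall_eq_Icc]
    exact fun y hy => by rw [mem_Iio]; linarith [hy.2]
  rw [indicator_of_mem (by simpa using hxq.le)]
  rcases lt_or_gt_of_ne hx1 with hx1 | hx1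
  · simp only [hG, hx1.le, if_true]
    refine tendsto_nhds_unique hx (tendsto_const_nhds.congr' ?_)
    filter_upwards [hsmall (lt_min (sub_pos.2 hxq) (sub_pos.2 hx1))] with ε ⟨hε0, hε⟩
    have hε1 := hε.trans_le (min_le_left _ _)
    have hε2 := hε.trans_le (min_le_right _ _)
    refine le_antisymm ?_ (hDle x ε)
    rw [ENNReal.le_div_iff_mul_le (Or.inl (hball0 x ε hxq.le hε0)) (Or.inl (hballt _ _)),
      Real.closedBall_eq_Icc]
    exact hge _ _ (by linarith) (by linarith)
  · simp only [hG, hx1.not_ge, if_false]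
    rw [hx.limsup_eq, min_eq_right]
    exact le_of_tendsto' hx (hDle x)

/-- Some mixture has a density with respect to `lam` that vanishes below `q`, is constant on
`[q, 1]` and non-increasing on `[q, ∞)`. -/
theorem exists_mixture_antitone_density (hpos : ∀ a b, q ≤ a → a < b → 0 < lam (Ioo a b))
    (hq1 : q < 1) (hρ : Continuous ρ) (hsupp : ∀ x, (ρ x : Measure ℝ) (Iio x) = 0)
    (hdec : ∀ x : Icc q 1, HasDecreasingMeans lam (ρ x) x) :
    ∃ m : ProbabilityMeasure (Icc q 1), ∃ c : ℝ, 0 < c ∧ ∃ G : ℝ → ℝ≥0∞, Antitone G ∧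
      (∀ t ≤ 1, G t = ENNReal.ofReal c) ∧
      (mixture m ρ hρ : Measure ℝ) = lam.withDensity ((Ici q).indicator G) := by
  obtain ⟨m, c, hle, hge⟩ := exists_mixture_uniform hpos hq1 hρ hsupp hdec
  obtain ⟨G, hG, hGc, h⟩ := exists_antitone_density ENNReal.ofReal_ne_top hpos hq1
    (mixture_Iio_eq_zero m hρ hsupp) hle hge (hasDecreasingMeans_mixture m hρ hdec)
  refine ⟨m, c, lt_of_not_ge fun hc => ?_, G, hG, hGc, h⟩
  have := measure_le_smul_of_Icc_le ENNReal.ofReal_ne_top hle univ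
  simp [ENNReal.ofReal_of_nonpos hc] at this

end OneDimensional

section Radial

variable {E : Type*} [NormedAddCommGroup E] [InnerProductSpace ℝ E] [FiniteDimensional ℝ E]
  [MeasurableSpace E] [BorelSpace E]

theorem nullSingletonClass_map_norm_volume [Nontrivial E] :
    NullSingletonClass ((volume : Measure E).map fun z => ‖z‖) := by
  refine ⟨fun t => ?_⟩
  rw [Measure.map_apply measurable_norm (measurableSet_singleton t)]
  convert Measure.addHaar_sphere (volume : Measure E) 0 t using 2
  ext z
  simp

theorem isLocallyFiniteMeasure_map_norm_volume :
    IsLocallyFiniteMeasure ((volume : Measure E).map fun z => ‖z‖) := by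
  refine ⟨fun t => ⟨Iio (t + 1), Iio_mem_nhds (by linarith), ?_⟩⟩
  rw [Measure.map_apply measurable_norm measurableSet_Iio]
  convert measure_ball_lt_top (μ := (volume : Measure E)) (x := 0) (r := t + 1) using 2
  ext z
  simp

theorem map_norm_volume_Ioo_pos [Nontrivial E] {a b : ℝ} (ha : 0 ≤ a) (hab : a < b) :
    0 < ((volume : Measure E).map fun z => ‖z‖) (Ioo a b) := by
  rw [Measure.map_apply measurable_norm measurableSet_Ioo]
  refine (isOpen_Ioo.preimage continuous_norm).measure_pos _ ?_
  obtain ⟨z, hz⟩ := exists_norm_eq E (by linarith : 0 ≤ (a + b) / 2)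
  exact ⟨z, by rw [mem_preimage, hz]; constructor <;> linarith⟩

/-- The radial part of a measure with a radially non-increasing density outside a ball has
decreasing means. -/
theorem hasDecreasingMeans_map_norm {α : Measure E} {r : ℝ} {g : ℝ → ℝ≥0∞}
    (hg : ∀ s t : ℝ, r < s → s ≤ t → g t ≤ g s)
    (hα : ∀ A : Set E, MeasurableSet A → A ⊆ (closedBall (0 : E) r)ᶜ → α A = ∫⁻ z in A, g ‖z‖) :
    HasDecreasingMeans ((volume : Measure E).map fun z => ‖z‖) (α.map fun z => ‖z‖) r := by
  intro s hs A B hA hB hAs hBs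
  have hout : ∀ {S : Set ℝ}, S ⊆ Ioi r → (fun z : E => ‖z‖) ⁻¹' S ⊆ (closedBall (0 : E) r)ᶜ := by
    intro S hS z hz
    simpa using hS hz
  have hA' := measurable_norm (α := E) hA
  have hB' := measurable_norm (α := E) hB
  simp only [Measure.map_apply measurable_norm, hA, hB]
  rw [hα _ hA' (hout fun y hy => (hAs hy).1), hα _ hB' (hout fun y hy => hs.trans_le (hBs hy))]
  have h1 : ∫⁻ z in (fun z : E => ‖z‖) ⁻¹' B, g ‖z‖ ≤ g s * volume ((fun z : E => ‖z‖) ⁻¹' B) := by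
    rw [← setLIntegral_const]
    exact setLIntegral_mono' hB' fun z hz => hg s _ hs (hBs hz)
  have h2 : g s * volume ((fun z : E => ‖z‖) ⁻¹' A) ≤ ∫⁻ z in (fun z : E => ‖z‖) ⁻¹' A, g ‖z‖ := by
    rw [← setLIntegral_const]
    exact setLIntegral_mono' hA' fun z hz => hg _ s (hAs hz).1 (hAs hz).2
  calc _ ≤ g s * volume ((fun z : E => ‖z‖) ⁻¹' B) * volume ((fun z : E => ‖z‖) ⁻¹' A) := by
        gcongr
    _ = g s * volume ((fun z : E => ‖z‖) ⁻¹' A) * volume ((fun z : E => ‖z‖) ⁻¹' B) := by ring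
    _ ≤ _ := by gcongr

/-- A rotation invariant measure whose radial part has density `g` with respect to the radial part
of Lebesgue measure has density `g ‖z‖`. -/
theorem eq_withDensity_norm_of_rotation_invariant [Nontrivial E] {α : Measure E}
    [IsFiniteMeasure α] (hα : ∀ O : E ≃ₗᵢ[ℝ] E, α.map O = α) {g : ℝ → ℝ≥0∞} (hg : Measurable g)
    (h : α.map (fun z => ‖z‖) = ((volume : Measure E).map fun z => ‖z‖).withDensity g) :
    α = volume.withDensity fun z => g ‖z‖ := by
  have hgn : Measurable fun z : E => g ‖z‖ := hg.comp measurable_norm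
  have hnorm : (volume.withDensity fun z : E => g ‖z‖).map (fun z => ‖z‖) =
      ((volume : Measure E).map fun z => ‖z‖).withDensity g := by
    ext A hA
    rw [Measure.map_apply measurable_norm hA, withDensity_apply _ (measurable_norm hA),
      withDensity_apply _ hA, setLIntegral_map hA hg measurable_norm]
  have : IsFiniteMeasure (volume.withDensity fun z : E => g ‖z‖) := ⟨by
    have h1 : (volume.withDensity fun z : E => g ‖z‖) univ = α univ := by
      rw [← preimage_univ (f := fun z : E => ‖z‖), ← Measure.map_apply measurable_norm .univ,
        hnorm, ← h, Measure.map_apply measurable_norm .univ]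
    exact h1 ▸ measure_lt_top α univ⟩
  refine ext_of_rotation_invariant hα (fun O => ?_) (h.trans hnorm.symm)
  ext A hA
  have hO : MeasurePreserving O (volume : Measure E) volume := O.measurePreserving
  rw [Measure.map_apply hO.measurable hA, withDensity_apply _ (hO.measurable hA),
    withDensity_apply _ hA, ← hO.setLIntegral_comp_preimage hA hgn]
  simp

end Radial

end Averaging

/-- Lemma C.3: Let `q ∈ [0,1)` and for `r ∈ [q,1]` let `P r` be an
isotropic unimodal probability measure on `ℝᵈ∖B(0,r)` (rotation invariant, vanishing on
`B(0,r)`, with radially non-increasing Lebesgue density outside the closed ball of radius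
`r`), depending vaguely continuously on `r`. Then there are a probability measure `μ` on
`[q,1]`, a constant `c > 0` and a radial density profile `g` for
`P̄(A) = ∫ P_r(A) μ(dr)` with `g = 0` on `[0,q)`, `g = c` on `[q,1)`, and `g ≤ c`
non-increasing on `[1,∞)`. -/
theorem statement19 (d : ℕ) (hd : 1 ≤ d) (q : ℝ) (hq0 : 0 ≤ q) (hq1 : q < 1)
    (P : ℝ → Measure (EuclideanSpace ℝ (Fin d)))
    (hprob : ∀ r ∈ Set.Icc q 1, IsProbabilityMeasure (P r))
    (hsupp : ∀ r ∈ Set.Icc q 1, P r (ball (0 : EuclideanSpace ℝ (Fin d)) r) = 0)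
    (hrot : ∀ r ∈ Set.Icc q 1,
      ∀ O : EuclideanSpace ℝ (Fin d) ≃ₗᵢ[ℝ] EuclideanSpace ℝ (Fin d),
        (P r).map O = P r)
    (hdens : ∀ r ∈ Set.Icc q 1, ∃ g : ℝ → ℝ≥0∞,
      (∀ s t : ℝ, r < s → s ≤ t → g t ≤ g s) ∧
      ∀ A : Set (EuclideanSpace ℝ (Fin d)), MeasurableSet A →
        A ⊆ (closedBall (0 : EuclideanSpace ℝ (Fin d)) r)ᶜ →
        P r A = ∫⁻ z in A, g ‖z‖)
    (hcont : ∀ f : EuclideanSpace ℝ (Fin d) → ℝ, Continuous f → HasCompactSupport f →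
      ContinuousOn (fun r => ∫ x, f x ∂(P r)) (Set.Icc q 1)) :
    ∃ μ : Measure ℝ, IsProbabilityMeasure μ ∧ μ (Set.Icc q 1)ᶜ = 0 ∧
      ∃ c : ℝ, 0 < c ∧ ∃ g : ℝ → ℝ≥0∞,
        (∀ t : ℝ, 0 ≤ t → t < q → g t = 0) ∧
        (∀ t : ℝ, q ≤ t → t < 1 → g t = ENNReal.ofReal c) ∧
        (∀ t : ℝ, 1 ≤ t → g t ≤ ENNReal.ofReal c) ∧
        (∀ s t : ℝ, 1 ≤ s → s ≤ t → g t ≤ g s) ∧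
        ∀ A : Set (EuclideanSpace ℝ (Fin d)), MeasurableSet A →
          (∫⁻ r, P r A ∂μ) = ∫⁻ z in A, g ‖z‖ := by
  have : NeZero d := ⟨by omega⟩
  have := nullSingletonClass_map_norm_volume (E := EuclideanSpace ℝ (Fin d))
  have := isLocallyFiniteMeasure_map_norm_volume (E := EuclideanSpace ℝ (Fin d))
  let Q : Set.Icc q 1 → ProbabilityMeasure (EuclideanSpace ℝ (Fin d)) :=
    fun x => ⟨P x, hprob x x.2⟩
  have hQ : Continuous Q := continuous_probabilityMeasure_of_vague Q fun f hf hfc =>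
    continuousOn_iff_continuous_domRestrict.1 (hcont f hf hfc)
  let ρ : Set.Icc q 1 → ProbabilityMeasure ℝ :=
    fun x => (Q x).map continuous_norm.measurable.aemeasurable
  have hρ : Continuous ρ := (ProbabilityMeasure.continuous_map continuous_norm).comp hQ
  have hρcoe : ∀ x, (ρ x : Measure ℝ) = (P x).map fun z => ‖z‖ := fun x => rfl
  obtain ⟨m, c, hc, G, hG, hGc, hmix⟩ := exists_mixture_antitone_density (hρ := hρ)
    (lam := (volume : Measure (EuclideanSpace ℝ (Fin d))).map fun z => ‖z‖)
    (fun a b ha hab => map_norm_volume_Ioo_pos (hq0.trans ha) hab) hq1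
    (fun x => by
      rw [hρcoe, Measure.map_apply measurable_norm measurableSet_Iio]
      refine measure_mono_null (fun z hz => ?_) (hsupp x x.2)
      simpa using hz)
    (fun x => by
      obtain ⟨g, hg, hgP⟩ := hdens x x.2
      exact hasDecreasingMeans_map_norm hg hgP)
  have hg : Measurable ((Set.Ici q).indicator G) := hG.measurable.indicator measurableSet_Ici
  have hrotmix : ∀ O : EuclideanSpace ℝ (Fin d) ≃ₗᵢ[ℝ] EuclideanSpace ℝ (Fin d),
      (mixture m Q hQ : Measure (EuclideanSpace ℝ (Fin d))).map O = mixture m Q hQ := by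
    intro O
    ext A hA
    have hO : Measurable O := O.continuous.measurable
    rw [Measure.map_apply hO hA, mixture_apply m hQ (hO hA), mixture_apply m hQ hA]
    refine lintegral_congr fun x => ?_
    rw [← Measure.map_apply hO hA]
    exact congrArg (fun ν : Measure _ => ν A) (hrot x x.2 O)
  have hradial : (mixture m Q hQ : Measure (EuclideanSpace ℝ (Fin d))).map (fun z => ‖z‖) =
      ((volume : Measure (EuclideanSpace ℝ (Fin d))).map fun z => ‖z‖).withDensity
        ((Set.Ici q).indicator G) := by
    rw [← hmix]
    ext A hA
    rw [Measure.map_apply measurable_norm hA, mixture_apply m hQ (measurable_norm hA),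
      mixture_apply m hρ hA]
    refine lintegral_congr fun x => ?_
    rw [hρcoe, Measure.map_apply measurable_norm hA]
    rfl
  have hemb : MeasurableEmbedding ((↑) : Set.Icc q 1 → ℝ) :=
    MeasurableEmbedding.subtype_coe measurableSet_Icc
  refine ⟨(m : Measure (Set.Icc q 1)).map (↑),
    Measure.isProbabilityMeasure_map measurable_subtype_coe.aemeasurable, ?_, c, hc,
    (Set.Ici q).indicator G, fun t _ ht => ?_, fun t hqt ht => ?_, fun t ht => ?_,
    fun s t hs hst => ?_, fun A hA => ?_⟩
  · rw [hemb.map_apply]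
    simp
  · exact Set.indicator_of_notMem (by simpa using ht) _
  · rw [Set.indicator_of_mem (by simpa using hqt), hGc t ht.le]
  · rw [Set.indicator_of_mem (by rw [Set.mem_Ici]; linarith), ← hGc 1 le_rfl]
    exact hG ht
  · rw [Set.indicator_of_mem (by rw [Set.mem_Ici]; linarith),
      Set.indicator_of_mem (by rw [Set.mem_Ici]; linarith)]
    exact hG hst
  · rw [hemb.lintegral_map, ← withDensity_apply _ hA,
      ← eq_withDensity_norm_of_rotation_invariant hrotmix hg hradial, mixture_apply m hQ hA]
    rfl
end
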